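/- arXiv:1801.06719 — 12 statements merged into one kernel-verified Lean document; each statement's English description precedes it below -/
import Mathlib

section
/- For any initial opinion vector x(0) ∈ ℝ^n, the Hegselmann–Krause dynamics terminates in a finite number of steps: there exist k* ∈ ℕ and x̄ ∈ ℝ^n such that x(k) = x̄ for all k ≥ k*. Moreover, in the final state every pair of agents i, j satisfies either x̄_i = x̄_j or |x̄_i − x̄_j| > d. -/
open Finset

/-- The agents trusted by agent `i` in the opinion profile `x`. -/
noncomputable def hkTrusted {n : ℕ} (d : ℝ) (x : Fin n → ℝ) (i : Fin n) : Finset (Fin n) :=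
  univ.filter (fun j => |x j - x i| ≤ d)

/-- One step of the Hegselmann–Krause dynamics. -/
noncomputable def hkStep {n : ℕ} (d : ℝ) (x : Fin n → ℝ) (i : Fin n) : ℝ :=
  (∑ j ∈ hkTrusted d x i, x j) / ((hkTrusted d x i).card : ℝ)

/-- The sum of squared opinion differences, truncated at `d ^ 2`. -/
noncomputable def hkEnergy {n : ℕ} (d : ℝ) (x : Fin n → ℝ) : ℝ :=
  ∑ i, ∑ j, min ((x i - x j) ^ 2) (d ^ 2)

theorem mem_hkTrusted {n : ℕ} {d : ℝ} {x : Fin n → ℝ} {i j : Fin n} :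
    j ∈ hkTrusted d x i ↔ |x j - x i| ≤ d := by
  simp [hkTrusted]

theorem self_mem_hkTrusted {n : ℕ} {d : ℝ} (hd : 0 < d) (x : Fin n → ℝ) (i : Fin n) :
    i ∈ hkTrusted d x i := by
  simp [mem_hkTrusted, hd.le]

theorem hkTrusted_card_pos {n : ℕ} {d : ℝ} (hd : 0 < d) (x : Fin n → ℝ) (i : Fin n) :
    (0 : ℝ) < (hkTrusted d x i).card :=
  Nat.cast_pos.mpr (Finset.card_pos.mpr ⟨i, self_mem_hkTrusted hd x i⟩)

theorem sum_sub_hkTrusted {n : ℕ} {d : ℝ} (hd : 0 < d) (x : Fin n → ℝ) (i : Fin n) :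
    ∑ j ∈ hkTrusted d x i, (x j - x i) =
      (hkTrusted d x i).card * (hkStep d x i - x i) := by
  have hc := (hkTrusted_card_pos hd x i).ne'
  rw [Finset.sum_sub_distrib, Finset.sum_const, nsmul_eq_mul, hkStep]
  field_simp

/-- Moving each agent to a weighted average decreases the weighted sum of squared differences. -/
theorem four_mul_sum_sq_le_of_weighted_average {ι : Type*} [Fintype ι]
    (a : ι → ι → ℝ) (x y : ι → ℝ) (ha : ∀ i j, 0 ≤ a i j) (hsymm : ∀ i j, a i j = a j i)
    (hdiag : ∀ i, a i i = 1)
    (hy : ∀ i, ∑ j, a i j * (x j - x i) = (∑ j, a i j) * (y i - x i)) :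
    4 * ∑ i, (y i - x i) ^ 2 ≤ ∑ i, ∑ j, a i j * ((x i - x j) ^ 2 - (y i - y j) ^ 2) := by
  have hrow : ∑ i, ∑ j, a i j * ((x j - x i) * (y i - x i) - (y i - x i) ^ 2) = 0 := by
    refine Finset.sum_eq_zero fun i _ => ?_
    calc _ = (∑ j, a i j * (x j - x i)) * (y i - x i) - (∑ j, a i j) * (y i - x i) ^ 2 := by
          rw [Finset.sum_mul, Finset.sum_mul, ← Finset.sum_sub_distrib]
          exact Finset.sum_congr rfl fun j _ => by ring
      _ = 0 := by rw [hy]; ring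
  have hcol : ∑ i, ∑ j, a i j * ((x i - x j) * (y j - x j) - (y j - x j) ^ 2) = 0 := by
    rw [Finset.sum_comm, ← hrow]
    exact Finset.sum_congr rfl fun i _ => Finset.sum_congr rfl fun j _ => by rw [hsymm]
  have hsplit : ∑ i, ∑ j, a i j * ((x i - x j) ^ 2 - (y i - y j) ^ 2) =
      2 * ∑ i, ∑ j, a i j * ((x j - x i) * (y i - x i) - (y i - x i) ^ 2) +
      2 * ∑ i, ∑ j, a i j * ((x i - x j) * (y j - x j) - (y j - x j) ^ 2) +
      ∑ i, ∑ j, a i j * ((y i - x i) + (y j - x j)) ^ 2 := by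
    simp only [Finset.mul_sum, ← Finset.sum_add_distrib]
    exact Finset.sum_congr rfl fun i _ => Finset.sum_congr rfl fun j _ => by ring
  rw [hsplit, hrow, hcol, Finset.mul_sum]
  simp only [mul_zero, zero_add]
  refine Finset.sum_le_sum fun i _ => ?_
  calc 4 * (y i - x i) ^ 2 = a i i * ((y i - x i) + (y i - x i)) ^ 2 := by rw [hdiag]; ring
    _ ≤ _ := Finset.single_le_sum (f := fun j => a i j * ((y i - x i) + (y j - x j)) ^ 2)
      (fun j _ => mul_nonneg (ha i j) (sq_nonneg _)) (Finset.mem_univ i)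

theorem hkEnergy_hkStep_add_le {n : ℕ} {d : ℝ} (hd : 0 < d) (x : Fin n → ℝ) :
    hkEnergy d (hkStep d x) + 4 * ∑ i, (hkStep d x i - x i) ^ 2 ≤ hkEnergy d x := by
  have h := four_mul_sum_sq_le_of_weighted_average
    (fun i j => if |x j - x i| ≤ d then (1 : ℝ) else 0) x (hkStep d x)
    (fun i j => by positivity) (fun i j => by simp only [abs_sub_comm])
    (fun i => by simp [hd.le])
    (fun i => by
      have h := sum_sub_hkTrusted hd x i
      rw [hkTrusted, Finset.sum_filter] at h
      simpa [-Finset.sum_sub_distrib] using h)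
  refine (add_le_add_right h _).trans ?_
  unfold hkEnergy
  simp only [← Finset.sum_add_distrib]
  refine Finset.sum_le_sum fun i _ => Finset.sum_le_sum fun j _ => ?_
  split_ifs with hij
  · have hsq : (x i - x j) ^ 2 ≤ d ^ 2 := by
      rw [abs_sub_comm] at hij
      exact sq_le_sq' (abs_le.mp hij).1 (abs_le.mp hij).2
    rw [min_eq_left hsq]
    linarith [min_le_left ((hkStep d x i - hkStep d x j) ^ 2) (d ^ 2)]
  · have hsq : d ^ 2 ≤ (x i - x j) ^ 2 := by
      rw [abs_sub_comm, not_le] at hij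
      rw [← sq_abs (x i - x j)]
      gcongr
    rw [min_eq_right hsq]
    linarith [min_le_right ((hkStep d x i - hkStep d x j) ^ 2) (d ^ 2)]

theorem exists_forall_abs_hkStep_sub_le {n : ℕ} {d : ℝ} (hd : 0 < d) (x : ℕ → Fin n → ℝ)
    (hx : ∀ k, x (k + 1) = hkStep d (x k)) {ε : ℝ} (hε : 0 < ε) :
    ∃ k, ∀ i, |hkStep d (x k) i - x k i| ≤ ε := by
  by_contra! hcon
  have hdec : ∀ k : ℕ, hkEnergy d (x k) + k * ε ^ 2 ≤ hkEnergy d (x 0) := by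
    intro k
    induction k with
    | zero => simp
    | succ k ih =>
      obtain ⟨i, hi⟩ := hcon k
      have hstep := hkEnergy_hkStep_add_le hd (x k)
      rw [← hx k] at hstep hi
      have hsingle := Finset.single_le_sum (f := fun i => (x (k + 1) i - x k i) ^ 2)
        (fun j _ => sq_nonneg _) (Finset.mem_univ i)
      have hsq : ε ^ 2 ≤ (x (k + 1) i - x k i) ^ 2 := by
        rw [← sq_abs (x (k + 1) i - x k i)]
        gcongr
      push_cast
      nlinarith [sq_nonneg ε]
  obtain ⟨k, hk⟩ := exists_nat_gt (hkEnergy d (x 0) / ε ^ 2)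
  rw [div_lt_iff₀ (by positivity)] at hk
  have hnonneg : 0 ≤ hkEnergy d (x k) := by
    unfold hkEnergy
    positivity
  linarith [hdec k]

/-- If the net pull on every agent is small, then mutually trusting agents are close. -/
theorem sub_le_of_forall_sum_le {n : ℕ} {d δ : ℝ} (hδ : 0 < δ) (hδd : (n + 2) * δ < d)
    (x : Fin n → ℝ) (hx : ∀ i, ∑ j ∈ hkTrusted d x i, (x j - x i) ≤ δ)
    (i j : Fin n) (hij : x j - x i ≤ d) : x j - x i ≤ δ := by
  by_contra! hlt
  obtain ⟨p, hp, hmin⟩ := Finset.exists_min_image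
    (univ.filter fun p => ∃ q, δ < x q - x p ∧ x q - x p ≤ d) x
    ⟨i, Finset.mem_filter.mpr ⟨Finset.mem_univ i, j, hlt, hij⟩⟩
  simp only [Finset.mem_filter, Finset.mem_univ, true_and] at hp hmin
  obtain ⟨q, hq, hqd⟩ := hp
  have hqmem : q ∈ hkTrusted d x p :=
    mem_hkTrusted.mpr (abs_le.mpr ⟨by linarith, hqd⟩)
  have hlow : ∀ l, x l < x p → x p - x l ≤ d → x p - x l ≤ δ := by
    intro l hl hld
    by_contra! h
    exact (hmin l ⟨p, h, hld⟩).not_gt hl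
  by_cases hex : ∃ l ∈ hkTrusted d x p, x l < x p
  · obtain ⟨l, hl, hlp⟩ := hex
    have hlδ := hlow l hlp (by linarith [(abs_le.mp (mem_hkTrusted.mp hl)).1])
    have hlq : d < x q - x l := by
      by_contra! h
      exact (hmin l ⟨q, by linarith, h⟩).not_gt hlp
    have hshift : x q - x p + δ ≤ ∑ m ∈ hkTrusted d x p, (x m - x p + δ) := by
      refine Finset.single_le_sum (f := fun m => x m - x p + δ) (fun m hm => ?_) hqmem
      rcases lt_or_ge (x m) (x p) with h | h
      · linarith [hlow m h (by linarith [(abs_le.mp (mem_hkTrusted.mp hm)).1])]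
      · linarith
    rw [Finset.sum_add_distrib, Finset.sum_const, nsmul_eq_mul] at hshift
    have hcard : ((hkTrusted d x p).card : ℝ) ≤ n := by
      exact_mod_cast (Finset.card_le_univ _).trans_eq (Fintype.card_fin n)
    nlinarith [hx p, mul_le_mul_of_nonneg_right hcard hδ.le]
  · push Not at hex
    have := Finset.single_le_sum (f := fun m => x m - x p)
      (fun m hm => sub_nonneg.mpr (hex m hm)) hqmem
    linarith [hx p]

/-- If mutually trusting agents are close, one step separates all disagreeing agents. -/
theorem hkStep_eq_or_lt {n : ℕ} {d δ : ℝ} (hd : 0 < d) (hδd : 2 * δ < d)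
    (x : Fin n → ℝ) (hx : ∀ i j, x j - x i ≤ d → x j - x i ≤ δ) (i j : Fin n) :
    hkStep d x i = hkStep d x j ∨ d < |hkStep d x i - hkStep d x j| := by
  wlog hle : x i ≤ x j generalizing i j
  · rw [eq_comm, abs_sub_comm]
    exact this j i (by linarith)
  have hclose : ∀ {a b}, a ∈ hkTrusted d x b → x a - x b ≤ δ ∧ x b - x a ≤ δ := fun {a b} h => by
    have := abs_le.mp (mem_hkTrusted.mp h)
    exact ⟨hx _ _ this.2, hx _ _ (by linarith)⟩
  by_cases hij : x j - x i ≤ d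
  · left
    have hδ := hx i j hij
    have heq : hkTrusted d x i = hkTrusted d x j := by
      ext m
      constructor <;> intro hm <;> have := hclose hm <;>
        exact mem_hkTrusted.mpr (abs_le.mpr ⟨by linarith, by linarith⟩)
    rw [hkStep, hkStep, heq]
  · right
    push Not at hij
    have hsep : ∀ a ∈ hkTrusted d x i, ∀ b ∈ hkTrusted d x j, x a + d < x b := by
      intro a ha b hb
      by_contra! h
      have h₁ := hclose ha
      have h₂ := hclose hb
      have h₃ := hx a b (by linarith)
      have h₄ := hx a j (by linarith)
      linarith
    obtain ⟨a, ha, hamax⟩ := Finset.exists_max_image (hkTrusted d x i) x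
      ⟨i, self_mem_hkTrusted hd x i⟩
    obtain ⟨b, hb, hbmin⟩ := Finset.exists_min_image (hkTrusted d x j) x
      ⟨j, self_mem_hkTrusted hd x j⟩
    have hle_a : hkStep d x i ≤ x a := by
      rw [hkStep, div_le_iff₀ (hkTrusted_card_pos hd x i), mul_comm, ← nsmul_eq_mul]
      exact Finset.sum_le_card_nsmul _ _ _ hamax
    have hb_le : x b ≤ hkStep d x j := by
      rw [hkStep, le_div_iff₀ (hkTrusted_card_pos hd x j), mul_comm, ← nsmul_eq_mul]
      exact Finset.card_nsmul_le_sum _ _ _ hbmin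
    rw [abs_sub_comm]
    exact lt_of_lt_of_le (by linarith [hsep a ha b hb]) (le_abs_self _)

theorem hkStep_eq_self {n : ℕ} {d : ℝ} (hd : 0 < d) (x : Fin n → ℝ)
    (hx : ∀ i j, x i = x j ∨ d < |x i - x j|) : hkStep d x = x := by
  funext i
  have hsum : ∑ j ∈ hkTrusted d x i, (x j - x i) = 0 :=
    Finset.sum_eq_zero fun j hj => sub_eq_zero.mpr <|
      (hx j i).resolve_right (not_lt.mpr (mem_hkTrusted.mp hj))
  rw [sum_sub_hkTrusted hd] at hsum
  exact sub_eq_zero.mp ((mul_eq_zero.mp hsum).resolve_left (hkTrusted_card_pos hd x i).ne')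

/-- **Termination of the scalar Hegselmann–Krause model.**
For any initial opinion vector, the HK dynamics (each agent moves to the
average of the opinions within distance `d` of its own) terminates in a
finite number of steps, and in the final state any two agents either agree
or are at distance greater than `d`. -/
theorem hk_terminates (n : ℕ) (d : ℝ) (hd : 0 < d)
    (x : ℕ → Fin n → ℝ)
    (hdyn : ∀ k i, x (k + 1) i =
      (∑ j ∈ univ.filter (fun j => |x k j - x k i| ≤ d), x k j) /
      ((univ.filter (fun j => |x k j - x k i| ≤ d)).card : ℝ)) :
    ∃ (kstar : ℕ) (xbar : Fin n → ℝ),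
      (∀ k, kstar ≤ k → x k = xbar) ∧
      (∀ i j, xbar i = xbar j ∨ d < |xbar i - xbar j|) := by
  have hstep : ∀ k, x (k + 1) = hkStep d (x k) := fun k => funext (hdyn k)
  have hδ : 0 < d / (n + 3) := by positivity
  have hδd : (n + 3) * (d / (n + 3)) = d := by field_simp
  set δ := d / (n + 3)
  have hn : (0 : ℝ) ≤ n := n.cast_nonneg
  obtain ⟨k, hk⟩ := exists_forall_abs_hkStep_sub_le hd x hstep
    (ε := δ / (n + 1)) (by positivity)
  have hpull : ∀ i, ∑ j ∈ hkTrusted d (x k) i, (x k j - x k i) ≤ δ := by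
    intro i
    have hcard : ((hkTrusted d (x k) i).card : ℝ) ≤ n + 1 := by
      have := (Finset.card_le_univ (hkTrusted d (x k) i)).trans_eq (Fintype.card_fin n)
      exact_mod_cast this.trans n.le_succ
    rw [sum_sub_hkTrusted hd]
    calc _ ≤ ((hkTrusted d (x k) i).card : ℝ) * (δ / (n + 1)) := by
          gcongr
          exact (le_abs_self _).trans (hk i)
      _ ≤ (n + 1) * (δ / (n + 1)) := by gcongr
      _ = δ := by field_simp
  have hfinal : ∀ i j, x (k + 1) i = x (k + 1) j ∨ d < |x (k + 1) i - x (k + 1) j| := by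
    rw [hstep]
    exact hkStep_eq_or_lt hd (by nlinarith) (x k)
      (sub_le_of_forall_sum_le hδ (by linarith) (x k) hpull)
  refine ⟨k + 1, x (k + 1), fun m hm => ?_, hfinal⟩
  induction m, hm using Nat.le_induction with
  | base => rfl
  | succ m _ ih => rw [hstep m, ih, hkStep_eq_self hd _ hfinal]
end

section
/- The HK operator C preserves the order of opinions: for any x ∈ ℝ^n and any indices i, j, if x_i ≤ x_j then C_i(x) ≤ C_j(x). In particular, if j_1,…,j_n is an ordering permutation with x_{j_1} ≤ … ≤ x_{j_n}, then C_{j_1}(x) ≤ … ≤ C_{j_n}(x). -/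
open Finset

/-- If every element of `A \ B` has value at most that of each element of `B`, and every element
of `B \ A` has value at least that of each element of `A`, then the mean over `A` is at most the
mean over `B`. -/
theorem sum_div_card_le_sum_div_card_of_sdiff {ι : Type*} [DecidableEq ι] {A B : Finset ι}
    {f : ι → ℝ} (hA : A.Nonempty) (hB : B.Nonempty)
    (hAB : ∀ a ∈ A \ B, ∀ b ∈ B, f a ≤ f b) (hBA : ∀ a ∈ A, ∀ b ∈ B \ A, f a ≤ f b) :
    (∑ a ∈ A, f a) / (A.card : ℝ) ≤ (∑ b ∈ B, f b) / (B.card : ℝ) := by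
  have hdiff (S T : Finset ι) : ∑ a ∈ S, ∑ b ∈ T, (f b - f a) =
      S.card * ∑ b ∈ T, f b - T.card * ∑ a ∈ S, f a := by
    simp [sum_sub_distrib, mul_sum]
  have hnonneg : 0 ≤ ∑ a ∈ A, ∑ b ∈ B, (f b - f a) := by
    have hsdiff : 0 ≤ ∑ a ∈ A \ B, ∑ b ∈ B, (f b - f a) :=
      sum_nonneg fun a ha => sum_nonneg fun b hb => sub_nonneg.2 (hAB a ha b hb)
    have hinter : 0 ≤ ∑ a ∈ A ∩ B, ∑ b ∈ B \ A, (f b - f a) :=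
      sum_nonneg fun a ha => sum_nonneg fun b hb =>
        sub_nonneg.2 (hBA a (mem_of_mem_inter_left ha) b hb)
    have hself : ∑ a ∈ A ∩ B, ∑ b ∈ A ∩ B, (f b - f a) = 0 := by rw [hdiff, sub_self]
    have hsplit : ∑ a ∈ A ∩ B, ∑ b ∈ B, (f b - f a) =
        ∑ a ∈ A ∩ B, ∑ b ∈ A ∩ B, (f b - f a) + ∑ a ∈ A ∩ B, ∑ b ∈ B \ A, (f b - f a) := by
      rw [← sum_add_distrib]
      exact sum_congr rfl fun a _ => by rw [inter_comm, sum_inter_add_sum_sdiff]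
    rw [← sum_inter_add_sum_sdiff A B, hsplit, hself, zero_add]
    exact add_nonneg hinter hsdiff
  rw [hdiff] at hnonneg
  rw [div_le_div_iff₀ (by exact_mod_cast hA.card_pos) (by exact_mod_cast hB.card_pos)]
  linarith

/-- **Order preservation of the Hegselmann–Krause operator.**
The HK operator `C`, where `C i x` is the average of the opinions within
distance `d` of `x i`, preserves the order of the opinions: if `x i ≤ x j`
then `C i x ≤ C j x`.  (In particular, applying this to an ordering
permutation `j₁,…,jₙ` with `x j₁ ≤ … ≤ x jₙ` yields
`C j₁ x ≤ … ≤ C jₙ x`.) -/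
theorem hk_order_preservation (n : ℕ) (d : ℝ) (hd : 0 < d)
    (x : Fin n → ℝ) (i j : Fin n) (hij : x i ≤ x j) :
    (∑ l ∈ univ.filter (fun l => |x l - x i| ≤ d), x l) /
      ((univ.filter (fun l => |x l - x i| ≤ d)).card : ℝ) ≤
    (∑ l ∈ univ.filter (fun l => |x l - x j| ≤ d), x l) /
      ((univ.filter (fun l => |x l - x j| ≤ d)).card : ℝ) := by
  refine sum_div_card_le_sum_div_card_of_sdiff ⟨i, by simp [hd.le]⟩ ⟨j, by simp [hd.le]⟩ ?_ ?_
  · intro a ha b hb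
    simp only [mem_sdiff, mem_filter, mem_univ, true_and, abs_le, not_and, not_le] at ha hb
    by_contra! h
    linarith [ha.2 (by linarith)]
  · intro a ha b hb
    simp only [mem_sdiff, mem_filter, mem_univ, true_and, abs_le, not_and, not_le] at ha hb
    by_contra! h
    linarith [hb.2 (by linarith)]
end

section
/- Suppose the initial opinions are sorted in ascending order x_1(0) ≤ … ≤ x_n(0) and x_{i+1}(0) − x_i(0) > d for some index i. Then along the HK dynamics x_i(k) is non-increasing in k, x_{i+1}(k) is non-decreasing in k, and consequently x_{i+1}(k) − x_i(k) > d for all k; i.e., two maximal d-chains can never merge. -/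
open Finset

lemma sum_mul_card_le_sum_mul_card {ι : Type*} {f : ι → ℝ} {S T : Finset ι}
    (h : ∀ p ∈ S, ∀ q ∈ T, f p ≤ f q) :
    (∑ p ∈ S, f p) * (T.card : ℝ) ≤ (∑ q ∈ T, f q) * (S.card : ℝ) := by
  have key : ∑ p ∈ S, ∑ _q ∈ T, f p ≤ ∑ _p ∈ S, ∑ q ∈ T, f q :=
    sum_le_sum fun p hp => sum_le_sum fun q hq => h p hp q hq
  simp only [sum_const, nsmul_eq_mul, ← mul_sum] at key
  linarith

/-- The mean over `S` is at most the mean over `T` if `S \ T` lies below `T` and `T \ S` lies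
above `S`. -/
lemma mean_le_mean_of_sdiff {ι : Type*} [DecidableEq ι] {f : ι → ℝ} {S T : Finset ι}
    (hS : S.Nonempty) (hT : T.Nonempty)
    (h₁ : ∀ p ∈ S \ T, ∀ q ∈ T, f p ≤ f q) (h₂ : ∀ p ∈ S, ∀ q ∈ T \ S, f p ≤ f q) :
    (∑ p ∈ S, f p) / (S.card : ℝ) ≤ (∑ q ∈ T, f q) / (T.card : ℝ) := by
  rw [div_le_div_iff₀ (by exact_mod_cast hS.card_pos) (by exact_mod_cast hT.card_pos)]
  have hlow : (∑ p ∈ S \ T, f p) * (T.card : ℝ) ≤ (∑ q ∈ T, f q) * ((S \ T).card : ℝ) :=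
    sum_mul_card_le_sum_mul_card h₁
  have hhigh : (∑ p ∈ S ∩ T, f p) * ((T \ S).card : ℝ) ≤
      (∑ q ∈ T \ S, f q) * ((S ∩ T).card : ℝ) :=
    sum_mul_card_le_sum_mul_card fun p hp => h₂ p (mem_of_mem_inter_left hp)
  have sS : ∑ p ∈ S ∩ T, f p + ∑ p ∈ S \ T, f p = ∑ p ∈ S, f p :=
    sum_inter_add_sum_sdiff S T f
  have sT : ∑ p ∈ S ∩ T, f p + ∑ p ∈ T \ S, f p = ∑ p ∈ T, f p := by
    rw [inter_comm]; exact sum_inter_add_sum_sdiff T S f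
  have cS : ((S ∩ T).card : ℝ) + (S \ T).card = S.card := by
    exact_mod_cast card_inter_add_card_sdiff S T
  have cT : ((S ∩ T).card : ℝ) + (T \ S).card = T.card := by
    rw [inter_comm]; exact_mod_cast card_inter_add_card_sdiff T S
  rw [← sS, ← cS]
  rw [← sT, ← cT] at hlow ⊢
  linarith

/-- The set of agents whose opinions lie within `d` of that of agent `a`. -/
noncomputable abbrev trusted {ι : Type*} [Fintype ι] (d : ℝ) (y : ι → ℝ) (a : ι) : Finset ι :=
  univ.filter (fun j => |y j - y a| ≤ d)

lemma trusted_nonempty {ι : Type*} [Fintype ι] {d : ℝ} (hd : 0 ≤ d) (y : ι → ℝ) (a : ι) :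
    (trusted d y a).Nonempty :=
  ⟨a, by simpa using hd⟩

/-- The Hegselmann–Krause update preserves the order of opinions. -/
lemma trusted_mean_le_trusted_mean {ι : Type*} [Fintype ι] {d : ℝ} (hd : 0 ≤ d) {y : ι → ℝ}
    {a b : ι} (hab : y a ≤ y b) :
    (∑ j ∈ trusted d y a, y j) / ((trusted d y a).card : ℝ) ≤
      (∑ j ∈ trusted d y b, y j) / ((trusted d y b).card : ℝ) := by
  classical
  refine mean_le_mean_of_sdiff (trusted_nonempty hd y a) (trusted_nonempty hd y b) ?_ ?_ <;>
  · intro p hp q hq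
    simp only [mem_sdiff, mem_filter, mem_univ, true_and, abs_le, not_and_or, not_le] at hp hq
    grind

/-- An agent separated from its upper neighbour by a gap larger than `d` does not move up. -/
lemma trusted_mean_le_of_gap {n : ℕ} {d : ℝ} (hd : 0 ≤ d) {y : Fin n → ℝ} (hy : Monotone y)
    {i j : Fin n} (hj : (j : ℕ) = (i : ℕ) + 1) (hgap : d < y j - y i) :
    (∑ l ∈ trusted d y i, y l) / ((trusted d y i).card : ℝ) ≤ y i := by
  rw [div_le_iff₀ (by exact_mod_cast (trusted_nonempty hd y i).card_pos), mul_comm,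
    ← nsmul_eq_mul]
  refine sum_le_card_nsmul _ _ _ fun l hl => ?_
  rcases le_or_gt l i with h | h
  · exact hy h
  · have hjl : y j ≤ y l := hy (Fin.le_def.2 (by have := Fin.lt_def.1 h; omega))
    have := (abs_le.1 (mem_filter.1 hl).2).2
    linarith

/-- An agent separated from its lower neighbour by a gap larger than `d` does not move down. -/
lemma le_trusted_mean_of_gap {n : ℕ} {d : ℝ} (hd : 0 ≤ d) {y : Fin n → ℝ} (hy : Monotone y)
    {i j : Fin n} (hj : (j : ℕ) = (i : ℕ) + 1) (hgap : d < y j - y i) :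
    y j ≤ (∑ l ∈ trusted d y j, y l) / ((trusted d y j).card : ℝ) := by
  rw [le_div_iff₀ (by exact_mod_cast (trusted_nonempty hd y j).card_pos), mul_comm,
    ← nsmul_eq_mul]
  refine card_nsmul_le_sum _ _ _ fun l hl => ?_
  rcases le_or_gt j l with h | h
  · exact hy h
  · have hli : y l ≤ y i := hy (Fin.le_def.2 (by have := Fin.lt_def.1 h; omega))
    have := (abs_le.1 (mem_filter.1 hl).2).1
    linarith

/-- **Maximal `d`-chains never merge.**
If the initial opinions are sorted in ascending order and there is a gap
larger than `d` between the opinions of agents `i` and `i+1`, then along the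
HK dynamics the opinion of agent `i` is non-increasing in time, the opinion
of agent `i+1` is non-decreasing in time, and consequently the gap between
them stays larger than `d` forever. -/
theorem hk_chains_never_merge (n : ℕ) (d : ℝ) (hd : 0 < d)
    (x : ℕ → Fin n → ℝ)
    (hdyn : ∀ k i, x (k + 1) i =
      (∑ j ∈ univ.filter (fun j => |x k j - x k i| ≤ d), x k j) /
      ((univ.filter (fun j => |x k j - x k i| ≤ d)).card : ℝ))
    (hsorted : Monotone (x 0))
    (i j : Fin n) (hj : (j : ℕ) = (i : ℕ) + 1)
    (hgap : d < x 0 j - x 0 i) :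
    (∀ k, x (k + 1) i ≤ x k i) ∧
    (∀ k, x k j ≤ x (k + 1) j) ∧
    (∀ k, d < x k j - x k i) := by
  have hmono : ∀ k, Monotone (x k) := by
    intro k
    induction k with
    | zero => exact hsorted
    | succ k ih =>
      intro a b hab
      rw [hdyn k a, hdyn k b]
      exact trusted_mean_le_trusted_mean hd.le (ih hab)
  have hdown : ∀ k, d < x k j - x k i → x (k + 1) i ≤ x k i := fun k h =>
    (hdyn k i).le.trans (trusted_mean_le_of_gap hd.le (hmono k) hj h)
  have hup : ∀ k, d < x k j - x k i → x k j ≤ x (k + 1) j := fun k h =>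
    (le_trusted_mean_of_gap hd.le (hmono k) hj h).trans (hdyn k j).ge
  have hgaps : ∀ k, d < x k j - x k i := by
    intro k
    induction k with
    | zero => exact hgap
    | succ k ih => linarith [hdown k ih, hup k ih]
  exact ⟨fun k => hdown k (hgaps k), fun k => hup k (hgaps k), hgaps⟩
end

section
/- If two agents i and j belong to different connected components of the influence graph G(x(k_0)) of the HK model at some step k_0, then there is no walk connecting i and j in any of the graphs G(x(k)) for k ≥ k_0; that is, connected components of the influence graph can split as k grows but can never merge. -/
open Finset

/-- The opinion profile `y` has no opinion in the interval `(c, c + d]`, and the opinions of `i` and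
`j` lie to its left and to its right, respectively. -/
def SeparatedByGap {ι : Type*} (d : ℝ) (y : ι → ℝ) (c : ℝ) (i j : ι) : Prop :=
  (∀ m, y m ≤ c ∨ c + d < y m) ∧ y i ≤ c ∧ c + d < y j

theorem SeparatedByGap.not_reflTransGen {ι : Type*} {d c : ℝ} {y : ι → ℝ} {i j : ι} (hd : 0 ≤ d)
    (h : SeparatedByGap d y c i j) :
    ¬ Relation.ReflTransGen (fun a b => |y a - y b| ≤ d) i j := by
  obtain ⟨hgap, hi, hj⟩ := h
  have hle (b : ι) (hw : Relation.ReflTransGen (fun a b => |y a - y b| ≤ d) i b) : y b ≤ c := by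
    induction hw with
    | refl => exact hi
    | @tail a b _ hedge ih =>
      have := abs_le.mp hedge
      exact (hgap b).resolve_right (by linarith)
  exact fun hw => by linarith [hle j hw]

theorem exists_separatedByGap {ι : Type*} [Fintype ι] {d : ℝ} {y : ι → ℝ} {i j : ι}
    (hij : y i ≤ y j) (hsep : ¬ Relation.ReflTransGen (fun a b => |y a - y b| ≤ d) i j) :
    ∃ c, SeparatedByGap d y c i j := by
  classical
  obtain ⟨m, hm, hmax⟩ := (univ.filter fun m =>
    Relation.ReflTransGen (fun a b => |y a - y b| ≤ d) i m ∧ y m ≤ y j).exists_max_image y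
      ⟨i, by simp [Relation.ReflTransGen.refl, hij]⟩
  simp only [mem_filter, mem_univ, true_and] at hm hmax
  have hj : y m + d < y j := by
    by_contra! hle
    exact hsep (hm.1.tail (abs_le.mpr ⟨by linarith, by linarith [hm.2]⟩))
  refine ⟨y m, fun l => ?_, hmax i ⟨.refl, hij⟩, hj⟩
  by_contra! hl
  have hedge : |y m - y l| ≤ d := abs_le.mpr ⟨by linarith, by linarith⟩
  exact hl.1.not_ge (hmax l ⟨hm.1.tail hedge, by linarith⟩)

theorem SeparatedByGap.step {ι : Type*} [Fintype ι] {d c : ℝ} {y z : ι → ℝ} {i j : ι}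
    (hd : 0 ≤ d)
    (hz : ∀ i, z i = (∑ j ∈ univ.filter (fun j => |y j - y i| ≤ d), y j) /
      ((univ.filter (fun j => |y j - y i| ≤ d)).card : ℝ))
    (h : SeparatedByGap d y c i j) : SeparatedByGap d z c i j := by
  obtain ⟨hgap, hi, hj⟩ := h
  have hne (a : ι) : (univ.filter (fun j => |y j - y a| ≤ d)).Nonempty := ⟨a, by simp [hd]⟩
  have hpos (a : ι) : (0 : ℝ) < (univ.filter (fun j => |y j - y a| ≤ d)).card :=
    Nat.cast_pos.mpr (hne a).card_pos
  have hleft (a : ι) (ha : y a ≤ c) : z a ≤ c := by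
    rw [hz, div_le_iff₀ (hpos a), mul_comm, ← nsmul_eq_mul]
    refine sum_le_card_nsmul _ _ _ fun b hb => ?_
    have := abs_le.mp (mem_filter.mp hb).2
    exact (hgap b).resolve_right (by linarith)
  have hright (a : ι) (ha : c + d < y a) : c + d < z a := by
    rw [hz, lt_div_iff₀ (hpos a), mul_comm, ← nsmul_eq_mul, ← sum_const]
    refine sum_lt_sum_of_nonempty (hne a) fun b hb => ?_
    have := abs_le.mp (mem_filter.mp hb).2
    exact (hgap b).resolve_left (by linarith)
  exact ⟨fun m => (hgap m).imp (hleft m) (hright m), hleft i hi, hright j hj⟩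

/-- **Connected components of the HK influence graph never merge.**
If at some step `k₀` of the HK dynamics two agents `i` and `j` lie in
different connected components of the influence graph (i.e. they are not
joined by any walk of the edge relation `|x a - x b| ≤ d`), then for every
`k ≥ k₀` there is no walk connecting `i` and `j` in the influence graph of
`x k`: components can split but never merge. -/
theorem hk_components_never_merge (n : ℕ) (d : ℝ) (hd : 0 < d)
    (x : ℕ → Fin n → ℝ)
    (hdyn : ∀ k i, x (k + 1) i =
      (∑ j ∈ univ.filter (fun j => |x k j - x k i| ≤ d), x k j) /
      ((univ.filter (fun j => |x k j - x k i| ≤ d)).card : ℝ))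
    (i j : Fin n) (k₀ : ℕ)
    (hsep : ¬ Relation.ReflTransGen (fun a b => |x k₀ a - x k₀ b| ≤ d) i j) :
    ∀ k, k₀ ≤ k →
      ¬ Relation.ReflTransGen (fun a b => |x k a - x k b| ≤ d) i j := by
  have key (a b : Fin n) (hab : x k₀ a ≤ x k₀ b)
      (h : ¬ Relation.ReflTransGen (fun a b => |x k₀ a - x k₀ b| ≤ d) a b) (k : ℕ) (hk : k₀ ≤ k) :
      ¬ Relation.ReflTransGen (fun a b => |x k a - x k b| ≤ d) a b := by
    obtain ⟨c, hc⟩ := exists_separatedByGap hab h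
    refine SeparatedByGap.not_reflTransGen (c := c) hd.le ?_
    induction k, hk using Nat.le_induction with
    | base => exact hc
    | succ k _ ih => exact ih.step hd.le (hdyn k)
  have hsymm (k : ℕ) : Std.Symm fun a b => |x k a - x k b| ≤ d :=
    ⟨fun a b h => by rwa [abs_sub_comm]⟩
  intro k hk
  rcases le_total (x k₀ i) (x k₀ j) with hij | hji
  · exact key i j hij hsep k hk
  · exact fun hw => key j i hji (fun h => hsep (symm h)) k hk (symm hw)
end

section
/- For n = 3 agents whose sorted initial opinions x_1(0) ≤ x_2(0) ≤ x_3(0) form a d-chain (x_2(0) − x_1(0) ≤ d and x_3(0) − x_2(0) ≤ d), the HK dynamics reaches consensus in at most 2 steps: x_1(2) = x_2(2) = x_3(2). -/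
open Finset

/-- If every pair of agents is within the confidence range, averaging over trusted agents produces
the same value for all agents. -/
theorem trusted_average_eq_of_forall_abs_sub_le {ι : Type*} [Fintype ι] {d : ℝ} {y : ι → ℝ}
    (h : ∀ i j, |y j - y i| ≤ d) (i : ι) :
    (∑ j ∈ univ.filter (fun j => |y j - y i| ≤ d), y j) /
      ((univ.filter (fun j => |y j - y i| ≤ d)).card : ℝ) = (∑ j, y j) / Fintype.card ι := by
  rw [filter_true_of_mem fun j _ => h i j, card_univ]

/-- **Three-agent `d`-chains collapse to consensus in 2 steps.**
For `n = 3` agents whose sorted initial opinions form a `d`-chain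
(consecutive differences at most `d`), the HK dynamics reaches consensus in
at most 2 steps. -/
theorem hk_three_agents_consensus (d : ℝ) (hd : 0 < d)
    (x : ℕ → Fin 3 → ℝ)
    (hdyn : ∀ k i, x (k + 1) i =
      (∑ j ∈ univ.filter (fun j => |x k j - x k i| ≤ d), x k j) /
      ((univ.filter (fun j => |x k j - x k i| ≤ d)).card : ℝ))
    (hsorted : Monotone (x 0))
    (hchain1 : x 0 1 - x 0 0 ≤ d)
    (hchain2 : x 0 2 - x 0 1 ≤ d) :
    x 2 0 = x 2 1 ∧ x 2 1 = x 2 2 := by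
  have h01 : x 0 0 ≤ x 0 1 := hsorted (by decide)
  have h12 : x 0 1 ≤ x 0 2 := hsorted (by decide)
  suffices h : ∀ i j, |x 1 j - x 1 i| ≤ d by
    have consensus : ∀ i, x 2 i = (∑ j, x 1 j) / Fintype.card (Fin 3) := fun i =>
      (hdyn 1 i).trans (trusted_average_eq_of_forall_abs_sub_le h i)
    simp only [consensus, and_self]
  by_cases hdiam : x 0 2 - x 0 0 ≤ d
  · have hclose : ∀ i j, |x 0 j - x 0 i| ≤ d := by
      intro i j
      rw [abs_le]
      fin_cases i <;> fin_cases j <;> constructor <;> dsimp <;> linarith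
    have consensus : ∀ i, x 1 i = (∑ j, x 0 j) / Fintype.card (Fin 3) := fun i =>
      (hdyn 0 i).trans (trusted_average_eq_of_forall_abs_sub_le hclose i)
    intro i j
    simpa [consensus] using hd.le
  · have t0 : univ.filter (fun j => |x 0 j - x 0 0| ≤ d) = {0, 1} := by
      ext j
      fin_cases j <;> simp [abs_le] <;> grind
    have t1 : univ.filter (fun j => |x 0 j - x 0 1| ≤ d) = {0, 1, 2} := by
      ext j
      fin_cases j <;> simp [abs_le] <;> grind
    have t2 : univ.filter (fun j => |x 0 j - x 0 2| ≤ d) = {1, 2} := by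
      ext j
      fin_cases j <;> simp [abs_le] <;> grind
    have e0 : x 1 0 = (x 0 0 + x 0 1) / 2 := by
      rw [hdyn 0 0, t0]
      simp
    have e1 : x 1 1 = (x 0 0 + (x 0 1 + x 0 2)) / 3 := by
      rw [hdyn 0 1, t1]
      simp
    have e2 : x 1 2 = (x 0 1 + x 0 2) / 2 := by
      rw [hdyn 0 2, t2]
      simp
    intro i j
    rw [abs_le]
    fin_cases i <;> fin_cases j <;> constructor <;> dsimp <;> linarith
end

section
/- For n = 4 agents whose sorted initial opinions x_1(0) ≤ x_2(0) ≤ x_3(0) ≤ x_4(0) form a d-chain (each consecutive difference at most d), the HK dynamics reaches consensus in at most 5 steps: x_1(5) = x_2(5) = x_3(5) = x_4(5). -/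
open Finset

/-- `x` is a trajectory of the four-agent HK dynamics with confidence range `d`. -/
def IsHKTrajectory (d : ℝ) (x : ℕ → Fin 4 → ℝ) : Prop :=
  ∀ k i, x (k + 1) i =
    (∑ j ∈ univ.filter (fun j => |x k j - x k i| ≤ d), x k j) /
    ((univ.filter (fun j => |x k j - x k i| ≤ d)).card : ℝ)

/-- The opinions `y` are sorted and form a `d`-chain. -/
structure IsSortedChain (d : ℝ) (y : Fin 4 → ℝ) : Prop where
  le01 : y 0 ≤ y 1
  le12 : y 1 ≤ y 2
  le23 : y 2 ≤ y 3
  gap01 : y 1 - y 0 ≤ d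
  gap12 : y 2 - y 1 ≤ d
  gap23 : y 3 - y 2 ≤ d

/-- All four opinions coincide. -/
def IsConsensus (y : Fin 4 → ℝ) : Prop :=
  y 0 = y 1 ∧ y 1 = y 2 ∧ y 2 = y 3

/-- Reflecting the opinions of a sorted chain and reversing the agents gives a sorted chain. -/
theorem IsSortedChain.reflect {d : ℝ} {y : Fin 4 → ℝ} (h : IsSortedChain d y) :
    IsSortedChain d (fun i => -y i.rev) := by
  obtain ⟨h1, h2, h3, h4, h5, h6⟩ := h
  constructor <;> simp [Fin.rev] <;> linarith

theorem IsConsensus.of_reflect {y : Fin 4 → ℝ} (h : IsConsensus (fun i => -y i.rev)) :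
    IsConsensus y := by
  obtain ⟨h1, h2, h3⟩ := h
  simp [Fin.rev] at h1 h2 h3
  exact ⟨h3.symm, h2.symm, h1.symm⟩

namespace IsHKTrajectory

variable {d : ℝ} {x : ℕ → Fin 4 → ℝ}

theorem update_eq (h : IsHKTrajectory d x) (k : ℕ) (i : Fin 4) :
    x (k + 1) i =
      ((if |x k 0 - x k i| ≤ d then x k 0 else 0) + (if |x k 1 - x k i| ≤ d then x k 1 else 0) +
        (if |x k 2 - x k i| ≤ d then x k 2 else 0) + (if |x k 3 - x k i| ≤ d then x k 3 else 0)) /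
      ((if |x k 0 - x k i| ≤ d then 1 else 0) + (if |x k 1 - x k i| ≤ d then 1 else 0) +
        (if |x k 2 - x k i| ≤ d then 1 else 0) + (if |x k 3 - x k i| ≤ d then 1 else 0)) := by
  rw [h k i, sum_filter, card_filter, Fin.sum_univ_four, Fin.sum_univ_four]
  push_cast
  rfl

/-- The HK dynamics is equivariant under reflection of the opinion space. -/
theorem reflect (h : IsHKTrajectory d x) : IsHKTrajectory d (fun k i => -x k i.rev) := by
  intro k i
  have habs : ∀ a b : ℝ, |-a - -b| = |a - b| := fun a b => by
    rw [neg_sub_neg, abs_sub_comm]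
  beta_reduce
  rw [h.update_eq, sum_filter, card_filter, Fin.sum_univ_four, Fin.sum_univ_four]
  simp only [habs]
  push_cast
  rw [← neg_div]
  congr 1
  · split_ifs <;> ring
  · ring

/-- When only consecutive agents trust each other, the interaction graph is a path. -/
theorem step_path (h : IsHKTrajectory d x) {k : ℕ} (hc : IsSortedChain d (x k))
    (h02 : d < x k 2 - x k 0) (h13 : d < x k 3 - x k 1) :
    x (k + 1) 0 = (x k 0 + x k 1) / 2 ∧
    x (k + 1) 1 = (x k 0 + x k 1 + x k 2) / 3 ∧
    x (k + 1) 2 = (x k 1 + x k 2 + x k 3) / 3 ∧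
    x (k + 1) 3 = (x k 2 + x k 3) / 2 := by
  obtain ⟨h1, h2, h3, h4, h5, h6⟩ := hc
  have e00 : |x k 0 - x k 0| ≤ d := by rw [abs_le]; constructor <;> linarith
  have e10 : |x k 1 - x k 0| ≤ d := by rw [abs_le]; constructor <;> linarith
  have e20 : ¬ |x k 2 - x k 0| ≤ d := not_le.2 (lt_abs.2 (Or.inl (by linarith)))
  have e30 : ¬ |x k 3 - x k 0| ≤ d := not_le.2 (lt_abs.2 (Or.inl (by linarith)))
  have e01 : |x k 0 - x k 1| ≤ d := by rw [abs_le]; constructor <;> linarith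
  have e11 : |x k 1 - x k 1| ≤ d := by rw [abs_le]; constructor <;> linarith
  have e21 : |x k 2 - x k 1| ≤ d := by rw [abs_le]; constructor <;> linarith
  have e31 : ¬ |x k 3 - x k 1| ≤ d := not_le.2 (lt_abs.2 (Or.inl (by linarith)))
  have e02 : ¬ |x k 0 - x k 2| ≤ d := not_le.2 (lt_abs.2 (Or.inr (by linarith)))
  have e12 : |x k 1 - x k 2| ≤ d := by rw [abs_le]; constructor <;> linarith
  have e22 : |x k 2 - x k 2| ≤ d := by rw [abs_le]; constructor <;> linarith
  have e32 : |x k 3 - x k 2| ≤ d := by rw [abs_le]; constructor <;> linarith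
  have e03 : ¬ |x k 0 - x k 3| ≤ d := not_le.2 (lt_abs.2 (Or.inr (by linarith)))
  have e13 : ¬ |x k 1 - x k 3| ≤ d := not_le.2 (lt_abs.2 (Or.inr (by linarith)))
  have e23 : |x k 2 - x k 3| ≤ d := by rw [abs_le]; constructor <;> linarith
  have e33 : |x k 3 - x k 3| ≤ d := by rw [abs_le]; constructor <;> linarith
  refine ⟨?_, ?_, ?_, ?_⟩
  · rw [h.update_eq, if_pos e00, if_pos e10, if_neg e20, if_neg e30,
      if_pos e00, if_pos e10, if_neg e20, if_neg e30]
    ring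
  · rw [h.update_eq, if_pos e01, if_pos e11, if_pos e21, if_neg e31,
      if_pos e01, if_pos e11, if_pos e21, if_neg e31]
    ring
  · rw [h.update_eq, if_neg e02, if_pos e12, if_pos e22, if_pos e32,
      if_neg e02, if_pos e12, if_pos e22, if_pos e32]
    ring
  · rw [h.update_eq, if_neg e03, if_neg e13, if_pos e23, if_pos e33,
      if_neg e03, if_neg e13, if_pos e23, if_pos e33]
    ring

/-- The interaction graph is a triangle on the agents `0, 1, 2` with the pendant edge `2 - 3`. -/
theorem step_left (h : IsHKTrajectory d x) {k : ℕ} (hc : IsSortedChain d (x k))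
    (h02 : x k 2 - x k 0 ≤ d) (h13 : d < x k 3 - x k 1) :
    x (k + 1) 0 = (x k 0 + x k 1 + x k 2) / 3 ∧
    x (k + 1) 1 = (x k 0 + x k 1 + x k 2) / 3 ∧
    x (k + 1) 2 = (x k 0 + x k 1 + x k 2 + x k 3) / 4 ∧
    x (k + 1) 3 = (x k 2 + x k 3) / 2 := by
  obtain ⟨h1, h2, h3, h4, h5, h6⟩ := hc
  have e00 : |x k 0 - x k 0| ≤ d := by rw [abs_le]; constructor <;> linarith
  have e10 : |x k 1 - x k 0| ≤ d := by rw [abs_le]; constructor <;> linarith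
  have e20 : |x k 2 - x k 0| ≤ d := by rw [abs_le]; constructor <;> linarith
  have e30 : ¬ |x k 3 - x k 0| ≤ d := not_le.2 (lt_abs.2 (Or.inl (by linarith)))
  have e01 : |x k 0 - x k 1| ≤ d := by rw [abs_le]; constructor <;> linarith
  have e11 : |x k 1 - x k 1| ≤ d := by rw [abs_le]; constructor <;> linarith
  have e21 : |x k 2 - x k 1| ≤ d := by rw [abs_le]; constructor <;> linarith
  have e31 : ¬ |x k 3 - x k 1| ≤ d := not_le.2 (lt_abs.2 (Or.inl (by linarith)))
  have e02 : |x k 0 - x k 2| ≤ d := by rw [abs_le]; constructor <;> linarith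
  have e12 : |x k 1 - x k 2| ≤ d := by rw [abs_le]; constructor <;> linarith
  have e22 : |x k 2 - x k 2| ≤ d := by rw [abs_le]; constructor <;> linarith
  have e32 : |x k 3 - x k 2| ≤ d := by rw [abs_le]; constructor <;> linarith
  have e03 : ¬ |x k 0 - x k 3| ≤ d := not_le.2 (lt_abs.2 (Or.inr (by linarith)))
  have e13 : ¬ |x k 1 - x k 3| ≤ d := not_le.2 (lt_abs.2 (Or.inr (by linarith)))
  have e23 : |x k 2 - x k 3| ≤ d := by rw [abs_le]; constructor <;> linarith
  have e33 : |x k 3 - x k 3| ≤ d := by rw [abs_le]; constructor <;> linarith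
  refine ⟨?_, ?_, ?_, ?_⟩
  · rw [h.update_eq, if_pos e00, if_pos e10, if_pos e20, if_neg e30,
      if_pos e00, if_pos e10, if_pos e20, if_neg e30]
    ring
  · rw [h.update_eq, if_pos e01, if_pos e11, if_pos e21, if_neg e31,
      if_pos e01, if_pos e11, if_pos e21, if_neg e31]
    ring
  · rw [h.update_eq, if_pos e02, if_pos e12, if_pos e22, if_pos e32,
      if_pos e02, if_pos e12, if_pos e22, if_pos e32]
    ring
  · rw [h.update_eq, if_neg e03, if_neg e13, if_pos e23, if_pos e33,
      if_neg e03, if_neg e13, if_pos e23, if_pos e33]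
    ring

/-- Only the two extreme agents do not trust each other. -/
theorem step_both (h : IsHKTrajectory d x) {k : ℕ} (hc : IsSortedChain d (x k))
    (h02 : x k 2 - x k 0 ≤ d) (h13 : x k 3 - x k 1 ≤ d) (h03 : d < x k 3 - x k 0) :
    x (k + 1) 0 = (x k 0 + x k 1 + x k 2) / 3 ∧
    x (k + 1) 1 = (x k 0 + x k 1 + x k 2 + x k 3) / 4 ∧
    x (k + 1) 2 = (x k 0 + x k 1 + x k 2 + x k 3) / 4 ∧
    x (k + 1) 3 = (x k 1 + x k 2 + x k 3) / 3 := by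
  obtain ⟨h1, h2, h3, h4, h5, h6⟩ := hc
  have e00 : |x k 0 - x k 0| ≤ d := by rw [abs_le]; constructor <;> linarith
  have e10 : |x k 1 - x k 0| ≤ d := by rw [abs_le]; constructor <;> linarith
  have e20 : |x k 2 - x k 0| ≤ d := by rw [abs_le]; constructor <;> linarith
  have e30 : ¬ |x k 3 - x k 0| ≤ d := not_le.2 (lt_abs.2 (Or.inl (by linarith)))
  have e01 : |x k 0 - x k 1| ≤ d := by rw [abs_le]; constructor <;> linarith
  have e11 : |x k 1 - x k 1| ≤ d := by rw [abs_le]; constructor <;> linarith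
  have e21 : |x k 2 - x k 1| ≤ d := by rw [abs_le]; constructor <;> linarith
  have e31 : |x k 3 - x k 1| ≤ d := by rw [abs_le]; constructor <;> linarith
  have e02 : |x k 0 - x k 2| ≤ d := by rw [abs_le]; constructor <;> linarith
  have e12 : |x k 1 - x k 2| ≤ d := by rw [abs_le]; constructor <;> linarith
  have e22 : |x k 2 - x k 2| ≤ d := by rw [abs_le]; constructor <;> linarith
  have e32 : |x k 3 - x k 2| ≤ d := by rw [abs_le]; constructor <;> linarith
  have e03 : ¬ |x k 0 - x k 3| ≤ d := not_le.2 (lt_abs.2 (Or.inr (by linarith)))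
  have e13 : |x k 1 - x k 3| ≤ d := by rw [abs_le]; constructor <;> linarith
  have e23 : |x k 2 - x k 3| ≤ d := by rw [abs_le]; constructor <;> linarith
  have e33 : |x k 3 - x k 3| ≤ d := by rw [abs_le]; constructor <;> linarith
  refine ⟨?_, ?_, ?_, ?_⟩
  · rw [h.update_eq, if_pos e00, if_pos e10, if_pos e20, if_neg e30,
      if_pos e00, if_pos e10, if_pos e20, if_neg e30]
    ring
  · rw [h.update_eq, if_pos e01, if_pos e11, if_pos e21, if_pos e31,
      if_pos e01, if_pos e11, if_pos e21, if_pos e31]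
    ring
  · rw [h.update_eq, if_pos e02, if_pos e12, if_pos e22, if_pos e32,
      if_pos e02, if_pos e12, if_pos e22, if_pos e32]
    ring
  · rw [h.update_eq, if_neg e03, if_pos e13, if_pos e23, if_pos e33,
      if_neg e03, if_pos e13, if_pos e23, if_pos e33]
    ring

/-- All agents trust each other. -/
theorem step_complete (h : IsHKTrajectory d x) {k : ℕ} (hc : IsSortedChain d (x k))
    (h03 : x k 3 - x k 0 ≤ d) :
    x (k + 1) 0 = (x k 0 + x k 1 + x k 2 + x k 3) / 4 ∧
    x (k + 1) 1 = (x k 0 + x k 1 + x k 2 + x k 3) / 4 ∧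
    x (k + 1) 2 = (x k 0 + x k 1 + x k 2 + x k 3) / 4 ∧
    x (k + 1) 3 = (x k 0 + x k 1 + x k 2 + x k 3) / 4 := by
  obtain ⟨h1, h2, h3, h4, h5, h6⟩ := hc
  have e00 : |x k 0 - x k 0| ≤ d := by rw [abs_le]; constructor <;> linarith
  have e10 : |x k 1 - x k 0| ≤ d := by rw [abs_le]; constructor <;> linarith
  have e20 : |x k 2 - x k 0| ≤ d := by rw [abs_le]; constructor <;> linarith
  have e30 : |x k 3 - x k 0| ≤ d := by rw [abs_le]; constructor <;> linarith
  have e01 : |x k 0 - x k 1| ≤ d := by rw [abs_le]; constructor <;> linarith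
  have e11 : |x k 1 - x k 1| ≤ d := by rw [abs_le]; constructor <;> linarith
  have e21 : |x k 2 - x k 1| ≤ d := by rw [abs_le]; constructor <;> linarith
  have e31 : |x k 3 - x k 1| ≤ d := by rw [abs_le]; constructor <;> linarith
  have e02 : |x k 0 - x k 2| ≤ d := by rw [abs_le]; constructor <;> linarith
  have e12 : |x k 1 - x k 2| ≤ d := by rw [abs_le]; constructor <;> linarith
  have e22 : |x k 2 - x k 2| ≤ d := by rw [abs_le]; constructor <;> linarith
  have e32 : |x k 3 - x k 2| ≤ d := by rw [abs_le]; constructor <;> linarith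
  have e03 : |x k 0 - x k 3| ≤ d := by rw [abs_le]; constructor <;> linarith
  have e13 : |x k 1 - x k 3| ≤ d := by rw [abs_le]; constructor <;> linarith
  have e23 : |x k 2 - x k 3| ≤ d := by rw [abs_le]; constructor <;> linarith
  have e33 : |x k 3 - x k 3| ≤ d := by rw [abs_le]; constructor <;> linarith
  refine ⟨?_, ?_, ?_, ?_⟩
  · rw [h.update_eq, if_pos e00, if_pos e10, if_pos e20, if_pos e30,
      if_pos e00, if_pos e10, if_pos e20, if_pos e30]
    ring
  · rw [h.update_eq, if_pos e01, if_pos e11, if_pos e21, if_pos e31,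
      if_pos e01, if_pos e11, if_pos e21, if_pos e31]
    ring
  · rw [h.update_eq, if_pos e02, if_pos e12, if_pos e22, if_pos e32,
      if_pos e02, if_pos e12, if_pos e22, if_pos e32]
    ring
  · rw [h.update_eq, if_pos e03, if_pos e13, if_pos e23, if_pos e33,
      if_pos e03, if_pos e13, if_pos e23, if_pos e33]
    ring

theorem consensus_of_diameter_le (h : IsHKTrajectory d x) {k : ℕ} (hc : IsSortedChain d (x k))
    (h03 : x k 3 - x k 0 ≤ d) : IsConsensus (x (k + 1)) := by
  obtain ⟨e0, e1, e2, e3⟩ := h.step_complete hc h03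
  refine ⟨?_, ?_, ?_⟩ <;> linarith

theorem consensus_succ (h : IsHKTrajectory d x) (hd : 0 < d) {k : ℕ} (hk : IsConsensus (x k)) :
    IsConsensus (x (k + 1)) := by
  obtain ⟨h1, h2, h3⟩ := hk
  refine h.consensus_of_diameter_le ?_ (by linarith)
  constructor <;> linarith

/-- If the agents `0, 2` and the agents `1, 3` trust each other, consensus takes two steps. -/
theorem consensus_of_both (h : IsHKTrajectory d x) (hd : 0 < d) {k : ℕ}
    (hc : IsSortedChain d (x k)) (h02 : x k 2 - x k 0 ≤ d) (h13 : x k 3 - x k 1 ≤ d) :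
    IsConsensus (x (k + 2)) := by
  rcases le_or_gt (x k 3 - x k 0) d with h03 | h03
  · exact h.consensus_succ hd (h.consensus_of_diameter_le hc h03)
  obtain ⟨e0, e1, e2, e3⟩ := h.step_both hc h02 h13 h03
  obtain ⟨h1, h2, h3, h4, h5, h6⟩ := hc
  refine h.consensus_of_diameter_le (k := k + 1) ?_ (by linarith)
  constructor <;> linarith

/-- If the agents `0, 2` trust each other, consensus takes at most three steps. -/
theorem consensus_of_left (h : IsHKTrajectory d x) (hd : 0 < d) {k : ℕ}
    (hc : IsSortedChain d (x k)) (h02 : x k 2 - x k 0 ≤ d) : IsConsensus (x (k + 3)) := by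
  rcases le_or_gt (x k 3 - x k 1) d with h13 | h13
  · exact h.consensus_succ hd (h.consensus_of_both hd hc h02 h13)
  obtain ⟨e0, e1, e2, e3⟩ := h.step_left hc h02 h13
  obtain ⟨h1, h2, h3, h4, h5, h6⟩ := hc
  have hc' : IsSortedChain d (x (k + 1)) := by constructor <;> linarith
  have h02' : x (k + 1) 2 - x (k + 1) 0 ≤ d := by linarith
  rcases le_or_gt (x (k + 1) 3 - x (k + 1) 1) d with h13' | h13'
  · exact h.consensus_of_both hd hc' h02' h13'
  obtain ⟨f0, f1, f2, f3⟩ := h.step_left hc' h02' h13'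
  refine h.consensus_of_diameter_le (k := k + 2) ?_ (by linarith)
  constructor <;> linarith

/-- If the agents `1, 3` trust each other, consensus takes at most three steps. -/
theorem consensus_of_right (h : IsHKTrajectory d x) (hd : 0 < d) {k : ℕ}
    (hc : IsSortedChain d (x k)) (h13 : x k 3 - x k 1 ≤ d) : IsConsensus (x (k + 3)) := by
  refine IsConsensus.of_reflect (h.reflect.consensus_of_left hd hc.reflect ?_)
  change -x k 1 - -x k 3 ≤ d
  linarith

/-- Either consensus is reached within three steps, or the interaction graph is a path and the
next profile is again a sorted chain. -/
theorem consensus_or_path (h : IsHKTrajectory d x) (hd : 0 < d) {k : ℕ}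
    (hc : IsSortedChain d (x k)) :
    IsConsensus (x (k + 3)) ∨ IsSortedChain d (x (k + 1)) ∧
      x (k + 1) 0 = (x k 0 + x k 1) / 2 ∧ x (k + 1) 1 = (x k 0 + x k 1 + x k 2) / 3 ∧
      x (k + 1) 2 = (x k 1 + x k 2 + x k 3) / 3 ∧ x (k + 1) 3 = (x k 2 + x k 3) / 2 := by
  rcases le_or_gt (x k 2 - x k 0) d with h02 | h02
  · exact Or.inl (h.consensus_of_left hd hc h02)
  rcases le_or_gt (x k 3 - x k 1) d with h13 | h13
  · exact Or.inl (h.consensus_of_right hd hc h13)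
  have e := h.step_path hc h02 h13
  refine Or.inr ⟨?_, e⟩
  obtain ⟨e0, e1, e2, e3⟩ := e
  obtain ⟨h1, h2, h3, h4, h5, h6⟩ := hc
  constructor <;> linarith

end IsHKTrajectory

/-- **Four-agent `d`-chains collapse to consensus in 5 steps.**
For `n = 4` agents whose sorted initial opinions form a `d`-chain
(consecutive differences at most `d`), the HK dynamics reaches consensus in
at most 5 steps. -/
theorem hk_four_agents_consensus (d : ℝ) (hd : 0 < d)
    (x : ℕ → Fin 4 → ℝ)
    (hdyn : ∀ k i, x (k + 1) i =
      (∑ j ∈ univ.filter (fun j => |x k j - x k i| ≤ d), x k j) /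
      ((univ.filter (fun j => |x k j - x k i| ≤ d)).card : ℝ))
    (hsorted : Monotone (x 0))
    (hchain1 : x 0 1 - x 0 0 ≤ d)
    (hchain2 : x 0 2 - x 0 1 ≤ d)
    (hchain3 : x 0 3 - x 0 2 ≤ d) :
    x 5 0 = x 5 1 ∧ x 5 1 = x 5 2 ∧ x 5 2 = x 5 3 := by
  have h : IsHKTrajectory d x := hdyn
  have hc : IsSortedChain d (x 0) :=
    ⟨hsorted (by decide), hsorted (by decide), hsorted (by decide), hchain1, hchain2, hchain3⟩
  rcases h.consensus_or_path hd hc with h3 | ⟨hc1, e0, e1, e2, e3⟩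
  · exact h.consensus_succ hd (h.consensus_succ hd h3)
  rcases h.consensus_or_path hd hc1 with h4 | ⟨hc2, f0, f1, f2, f3⟩
  · exact h.consensus_succ hd h4
  rcases h.consensus_or_path hd hc2 with h5 | ⟨hc3, g0, g1, g2, g3⟩
  · exact h5
  obtain ⟨h1, h2, h3, h4, h5, h6⟩ := hc
  norm_num at e0 e1 e2 e3 f0 f1 f2 f3 g0 g1 g2 g3 hc3
  exact h.consensus_of_both hd hc3 (by linarith) (by linarith)
end

section
/- For any norm ‖·‖ on ℝ^m, the multidimensional HK model terminates in a finite number of steps: for any initial opinions x_1(0),…,x_n(0) ∈ ℝ^m there exists k* such that x_i(k) = x_i(k*) for all i and all k ≥ k*. -/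
open Finset

section Averaging

open Filter

/-- The agents adjacent to `i` at time `k` form the set `nbhd k i`; every agent moves to the average
of the opinions of its neighbours. -/
def IsAveragingDynamics {ι : Type*} (nbhd : ℕ → ι → Finset ι) (y : ℕ → ι → ℝ) : Prop :=
  ∀ k i, y (k + 1) i = ((nbhd k i).card : ℝ)⁻¹ * ∑ j ∈ nbhd k i, y k j

variable {ι : Type*} {nbhd : ℕ → ι → Finset ι} {y : ℕ → ι → ℝ}

theorem IsAveragingDynamics.neg (hy : IsAveragingDynamics nbhd y) :
    IsAveragingDynamics nbhd (fun k i => -y k i) := fun k i => by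
  simp only [hy k i, Finset.sum_neg_distrib, mul_neg]

theorem IsAveragingDynamics.succ_sub (hy : IsAveragingDynamics nbhd y) {k : ℕ} {i : ι}
    (hi : (nbhd k i).Nonempty) (m : ℝ) :
    y (k + 1) i - m = ((nbhd k i).card : ℝ)⁻¹ * ∑ j ∈ nbhd k i, (y k j - m) := by
  have : ((nbhd k i).card : ℝ) ≠ 0 := by exact_mod_cast hi.card_pos.ne'
  rw [hy k i, Finset.sum_sub_distrib, Finset.sum_const, nsmul_eq_mul]
  field_simp

theorem IsAveragingDynamics.le_succ (hy : IsAveragingDynamics nbhd y) {k : ℕ} {i : ι}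
    (hi : (nbhd k i).Nonempty) {m : ℝ} (hm : ∀ j ∈ nbhd k i, m ≤ y k j) : m ≤ y (k + 1) i := by
  rw [← sub_nonneg, hy.succ_sub hi]
  exact mul_nonneg (by positivity) (Finset.sum_nonneg fun j hj => sub_nonneg.2 (hm j hj))

theorem IsAveragingDynamics.le_of_closed (hy : IsAveragingDynamics nbhd y)
    (hrefl : ∀ k i, i ∈ nbhd k i) {S : Finset ι} {t s : ℕ} (hts : t ≤ s)
    (hS : ∀ k, t ≤ k → k < s → ∀ i ∈ S, nbhd k i ⊆ S) {m : ℝ} (hm : ∀ i ∈ S, m ≤ y t i) :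
    ∀ i ∈ S, m ≤ y s i := by
  induction s, hts using Nat.le_induction with
  | base => exact hm
  | succ s hts ih =>
    intro i hi
    have ih' := ih fun k h₁ h₂ => hS k h₁ (h₂.trans s.lt_succ_self)
    exact hy.le_succ ⟨i, hrefl s i⟩ fun j hj => ih' j (hS s hts s.lt_succ_self i hi hj)

theorem IsAveragingDynamics.ge_of_closed (hy : IsAveragingDynamics nbhd y)
    (hrefl : ∀ k i, i ∈ nbhd k i) {S : Finset ι} {t s : ℕ} (hts : t ≤ s)
    (hS : ∀ k, t ≤ k → k < s → ∀ i ∈ S, nbhd k i ⊆ S) {M : ℝ} (hM : ∀ i ∈ S, y t i ≤ M) :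
    ∀ i ∈ S, y s i ≤ M := fun i hi =>
  neg_le_neg_iff.1 <| hy.neg.le_of_closed hrefl hts hS (fun j hj => neg_le_neg (hM j hj)) i hi

/-- `C` is eventually closed under adjacency, but no proper nonempty part of `C` is. -/
structure IsPersistentComponent (nbhd : ℕ → ι → Finset ι) (T : ℕ) (C : Finset ι) : Prop where
  closed : ∀ k, T ≤ k → ∀ i ∈ C, nbhd k i ⊆ C
  exists_crossing : ∀ S ⊆ C, S.Nonempty → S ≠ C → ∀ t, ∃ k, t ≤ k ∧ ∃ i ∈ S, ¬ nbhd k i ⊆ S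

variable [Fintype ι] {T : ℕ} {C : Finset ι}

theorem IsPersistentComponent.exists_lower_bound (hC : IsPersistentComponent nbhd T C)
    (hy : IsAveragingDynamics nbhd y) (hrefl : ∀ k i, i ∈ nbhd k i)
    (hsymm : ∀ k i j, j ∈ nbhd k i → i ∈ nbhd k j) {m : ℝ} (p : ℕ) :
    ∀ S ⊆ C, S.Nonempty → C.card ≤ S.card + p → ∀ t, T ≤ t → (∀ i ∈ C, m ≤ y t i) →
      ∀ a, 0 ≤ a → (∀ i ∈ S, m + a ≤ y t i) →
      ∃ s, t ≤ s ∧ ∀ i ∈ C, m + ((Fintype.card ι : ℝ)⁻¹) ^ p * a ≤ y s i := by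
  classical
  induction p with
  | zero =>
    intro S hSC _ hcard t _ _ a _ hSa
    obtain rfl := Finset.eq_of_subset_of_card_le hSC hcard
    exact ⟨t, le_rfl, by simpa using hSa⟩
  | succ p ih =>
    intro S hSC hS hcard t hTt hm a ha hSa
    have hι : 1 ≤ (Fintype.card ι : ℝ) := by
      have : Nonempty ι := ⟨hS.choose⟩
      exact_mod_cast Fintype.card_pos (α := ι)
    have hinv : (Fintype.card ι : ℝ)⁻¹ ≤ 1 := inv_le_one_of_one_le₀ hι
    by_cases hSeq : S = C
    · subst hSeq
      refine ⟨t, le_rfl, fun i hi => le_trans ?_ (hSa i hi)⟩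
      have := mul_le_of_le_one_left ha
        (pow_le_one₀ (n := p + 1) (by positivity : 0 ≤ (Fintype.card ι : ℝ)⁻¹) hinv)
      linarith
    have hex := hC.exists_crossing S hSC hS hSeq t
    let k := Nat.find hex
    obtain ⟨htk, i₀, hi₀, hcross⟩ := Nat.find_spec hex
    have hisol : ∀ l, t ≤ l → l < k → ∀ i ∈ S, nbhd l i ⊆ S := by
      intro l hl hlk i hi
      by_contra h
      exact Nat.find_min hex hlk ⟨hl, i, hi, h⟩
    have hSk := hy.le_of_closed hrefl htk hisol hSa
    have hmk := hy.le_of_closed hrefl htk (fun l hl _ => hC.closed l (hTt.trans hl)) hm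
    have hTk : T ≤ k := hTt.trans htk
    have hsub : S ⊆ S.biUnion (nbhd k) := fun i hi =>
      Finset.mem_biUnion.2 ⟨i, hi, hrefl k i⟩
    have hsubC : S.biUnion (nbhd k) ⊆ C :=
      Finset.biUnion_subset.2 fun i hi => hC.closed k hTk i (hSC hi)
    have hlt : S.card < (S.biUnion (nbhd k)).card := by
      refine Finset.card_lt_card ⟨hsub, fun h => hcross ?_⟩
      exact fun j hj => h (Finset.mem_biUnion.2 ⟨i₀, hi₀, hj⟩)
    obtain ⟨s, hs, hs'⟩ := ih (S.biUnion (nbhd k)) hsubC (hS.mono hsub) (by omega) (k + 1)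
      (by omega) (hy.le_of_closed hrefl (Nat.le_succ k)
        (fun l hl _ => hC.closed l (hTk.trans hl)) hmk)
      ((Fintype.card ι : ℝ)⁻¹ * a) (by positivity) (by
        intro j hj
        have hjC := hsubC hj
        obtain ⟨i, hi, hij⟩ := Finset.mem_biUnion.1 hj
        have hpos : 0 < ((nbhd k j).card : ℝ) := by
          exact_mod_cast Finset.card_pos.2 ⟨j, hrefl k j⟩
        have hcard_le : ((nbhd k j).card : ℝ) ≤ Fintype.card ι := by
          exact_mod_cast Finset.card_le_univ _
        have hsum : a ≤ ∑ l ∈ nbhd k j, (y k l - m) := by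
          refine le_trans ?_ (Finset.single_le_sum (f := fun l => y k l - m)
            (fun l hl => sub_nonneg.2 (hmk l (hC.closed k hTk j hjC hl))) (hsymm k i j hij))
          have := hSk i hi
          change a ≤ y k i - m
          linarith
        have hstep := hy.succ_sub ⟨j, hrefl k j⟩ m
        have : (Fintype.card ι : ℝ)⁻¹ * a ≤
            ((nbhd k j).card : ℝ)⁻¹ * ∑ l ∈ nbhd k j, (y k l - m) := by gcongr
        linarith)
    refine ⟨s, by omega, fun i hi => ?_⟩
    rw [pow_succ, mul_assoc]
    exact hs' i hi

theorem IsPersistentComponent.exists_contraction (hC : IsPersistentComponent nbhd T C)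
    (hy : IsAveragingDynamics nbhd y) (hrefl : ∀ k i, i ∈ nbhd k i)
    (hsymm : ∀ k i j, j ∈ nbhd k i → i ∈ nbhd k j) (hne : C.Nonempty) {t : ℕ} (hTt : T ≤ t)
    {m a : ℝ} (hm : ∀ i ∈ C, m ≤ y t i ∧ y t i ≤ m + a) :
    ∃ s, t ≤ s ∧ ∃ m', ∀ i ∈ C, m' ≤ y s i ∧
      y s i ≤ m' + (1 - ((Fintype.card ι : ℝ)⁻¹) ^ Fintype.card ι) * a := by
  obtain ⟨i₀, hi₀, hmax⟩ := Finset.exists_max_image C (y t) hne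
  have h₀ := hm i₀ hi₀
  obtain ⟨s, hts, hs⟩ := hC.exists_lower_bound hy hrefl hsymm (m := m) (Fintype.card ι) {i₀}
    (by simpa using hi₀) (by simp) ((Finset.card_le_univ C).trans (by omega)) t hTt
    (fun i hi => (hm i hi).1) (y t i₀ - m) (by linarith) (by simp)
  refine ⟨s, hts, _, fun i hi => ⟨hs i hi, ?_⟩⟩
  have hup := hy.ge_of_closed hrefl hts (fun k hk _ => hC.closed k (hTt.trans hk)) hmax i hi
  have hpow : ((Fintype.card ι : ℝ)⁻¹) ^ Fintype.card ι ≤ 1 :=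
    pow_le_one₀ (by positivity) (Nat.cast_inv_le_one _)
  nlinarith

/-- Consensus in a persistent component of a symmetric averaging dynamics. -/
theorem IsPersistentComponent.eventually_abs_sub_le (hC : IsPersistentComponent nbhd T C)
    (hy : IsAveragingDynamics nbhd y) (hrefl : ∀ k i, i ∈ nbhd k i)
    (hsymm : ∀ k i j, j ∈ nbhd k i → i ∈ nbhd k j) {ε : ℝ} (hε : 0 < ε) :
    ∀ᶠ k in atTop, ∀ i ∈ C, ∀ j ∈ C, |y k i - y k j| ≤ ε := by
  rcases C.eq_empty_or_nonempty with rfl | hne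
  · simp
  have : Nonempty ι := ⟨hne.choose⟩
  set r : ℝ := 1 - ((Fintype.card ι : ℝ)⁻¹) ^ Fintype.card ι with hr
  have hr₀ : 0 ≤ r := sub_nonneg.2 (pow_le_one₀ (by positivity) (Nat.cast_inv_le_one _))
  have hr₁ : r < 1 := by
    have hpos : 0 < (Fintype.card ι : ℝ) := by exact_mod_cast Fintype.card_pos (α := ι)
    have : 0 < ((Fintype.card ι : ℝ)⁻¹) ^ Fintype.card ι := by positivity
    linarith
  obtain ⟨i₀, hi₀, hmin⟩ := Finset.exists_min_image C (y T) hne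
  obtain ⟨i₁, hi₁, hmax⟩ := Finset.exists_max_image C (y T) hne
  set a := y T i₁ - y T i₀ with ha
  have hiter : ∀ p : ℕ, ∃ t, T ≤ t ∧ ∃ m, ∀ i ∈ C, m ≤ y t i ∧ y t i ≤ m + r ^ p * a := by
    intro p
    induction p with
    | zero =>
      exact ⟨T, le_rfl, y T i₀, fun i hi => ⟨hmin i hi, by linarith [hmax i hi]⟩⟩
    | succ p ih =>
      obtain ⟨t, hTt, m, hm⟩ := ih
      obtain ⟨s, hts, m', hm'⟩ := hC.exists_contraction hy hrefl hsymm hne hTt hm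
      exact ⟨s, hTt.trans hts, m', by rwa [pow_succ', mul_assoc]⟩
  have hlim : Tendsto (fun p : ℕ => r ^ p * a) atTop (nhds 0) := by
    simpa using (tendsto_pow_atTop_nhds_zero_of_lt_one hr₀ hr₁).mul_const a
  obtain ⟨p, hp⟩ := (hlim.eventually (gt_mem_nhds hε)).exists
  obtain ⟨t, hTt, m, hm⟩ := hiter p
  filter_upwards [eventually_ge_atTop t] with k hk i hi j hj
  have hcl : ∀ l, t ≤ l → l < k → ∀ i ∈ C, nbhd l i ⊆ C := fun l hl _ =>
    hC.closed l (hTt.trans hl)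
  have hlow := hy.le_of_closed hrefl hk hcl fun i hi => (hm i hi).1
  have hupp := hy.ge_of_closed hrefl hk hcl fun i hi => (hm i hi).2
  rw [abs_le]
  constructor <;> linarith [hlow i hi, hlow j hj, hupp i hi, hupp j hj]

/-- The classes of the relation generated by the edges that occur infinitely often are, from some
time on, persistent components. -/
theorem exists_isPersistentComponent (hsymm : ∀ k i j, j ∈ nbhd k i → i ∈ nbhd k j) :
    ∃ T, ∃ C : ι → Finset ι, (∀ i, i ∈ C i) ∧ (∀ i j, j ∈ C i → C j = C i) ∧
      ∀ i, IsPersistentComponent nbhd T (C i) := by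
  classical
  let P : ι → ι → Prop := fun i j => ∃ᶠ k in atTop, j ∈ nbhd k i
  have hP : ∀ᶠ k in atTop, ∀ i j, j ∈ nbhd k i → P i j := by
    refine eventually_all.2 fun i => eventually_all.2 fun j => ?_
    by_cases h : P i j
    · exact Eventually.of_forall fun _ _ => h
    · exact (not_frequently.1 h).mono fun k hk hj => absurd hj hk
  have hPsymm : Std.Symm P := ⟨fun i j h => h.mono fun k => hsymm k i j⟩
  obtain ⟨T, hT⟩ := eventually_atTop.1 hP
  refine ⟨T, fun i => Finset.univ.filter (Relation.ReflTransGen P i), ?_, ?_, ?_⟩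
  · intro i
    simpa using Relation.ReflTransGen.refl
  · intro i j hij
    have hij : Relation.ReflTransGen P i j := by simpa using hij
    ext l
    simp only [Finset.mem_filter, Finset.mem_univ, true_and]
    exact ⟨hij.trans, (symm hij).trans⟩
  · refine fun i => ⟨fun k hk j hj l hl => ?_, fun S hSC hS hne t => ?_⟩
    · simp only [Finset.mem_filter, Finset.mem_univ, true_and] at hj ⊢
      exact hj.tail (hT k hk j l hl)
    · by_contra! h
      obtain ⟨j, hj⟩ := hS
      refine hne (hSC.antisymm fun l hl => ?_)
      have hij := hSC hj
      simp only [Finset.mem_filter, Finset.mem_univ, true_and] at hij hl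
      have hjl : Relation.ReflTransGen P j l := (symm hij).trans hl
      clear hl
      induction hjl with
      | refl => exact hj
      | tail _ hbc ih =>
        obtain ⟨k, hk, hmem⟩ := frequently_atTop.1 hbc t
        exact h k hk _ ih hmem

end Averaging

section Seminorm

theorem seminorm_le_sum_abs_mul {κ : Type*} [Fintype κ] [DecidableEq κ] (p : Seminorm ℝ (κ → ℝ))
    (v : κ → ℝ) : p v ≤ ∑ c, |v c| * p (Pi.single c 1) := by
  calc p v = p (∑ c, v c • Pi.single c 1) := by rw [← pi_eq_sum_univ' v]
    _ ≤ ∑ c, p (v c • Pi.single c 1) :=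
        Finset.le_sum_of_subadditive p (map_zero p).le (map_add_le_add p) _ _
    _ = ∑ c, |v c| * p (Pi.single c 1) := by simp only [map_smul_eq_mul, Real.norm_eq_abs]

end Seminorm

/-- **Finite-time termination of the multidimensional HK model for any norm.**
Let `N` be an arbitrary norm on `ℝ^m` (subadditive, absolutely homogeneous
and definite).  Then the multidimensional HK dynamics, where each agent moves
to the average of the opinions within `N`-distance `d` of its own, terminates
in a finite number of steps. -/
theorem hk_multidim_terminates_any_norm (n m : ℕ) (d : ℝ) (hd : 0 < d)
    (N : (Fin m → ℝ) → ℝ)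
    (hN_add : ∀ v w, N (v + w) ≤ N v + N w)
    (hN_smul : ∀ (c : ℝ) v, N (c • v) = |c| * N v)
    (hN_def : ∀ v, N v = 0 → v = 0)
    (x : ℕ → Fin n → (Fin m → ℝ))
    (hdyn : ∀ k i, x (k + 1) i =
      (((univ.filter (fun j => N (x k j - x k i) ≤ d)).card : ℝ))⁻¹ •
        ∑ j ∈ univ.filter (fun j => N (x k j - x k i) ≤ d), x k j) :
    ∃ kstar : ℕ, ∀ k, kstar ≤ k → x k = x kstar := by
  let p : Seminorm ℝ (Fin m → ℝ) := Seminorm.of N hN_add hN_smul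
  set nbhd : ℕ → Fin n → Finset (Fin n) := fun k i => univ.filter fun j => N (x k j - x k i) ≤ d
    with hnbhd
  have hrefl : ∀ k i, i ∈ nbhd k i := fun k i => by
    simp only [hnbhd, mem_filter, mem_univ, true_and, sub_self]
    exact (map_zero p).trans_le hd.le
  have hsymm : ∀ k i j, j ∈ nbhd k i → i ∈ nbhd k j := fun k i j h => by
    simp only [hnbhd, mem_filter, mem_univ, true_and] at h ⊢
    exact (map_sub_rev p _ _).trans_le h
  have hy : ∀ c, IsAveragingDynamics nbhd fun k i => x k i c := fun c k i => by
    simp [hdyn k i, hnbhd]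
  obtain ⟨T, C, hself, hclass, hC⟩ := exists_isPersistentComponent hsymm
  obtain ⟨ε, hε, hεd⟩ : ∃ ε : ℝ, 0 < ε ∧ ε * ∑ c, p (Pi.single c 1) ≤ d := by
    have hsum : 0 ≤ ∑ c, p (Pi.single c 1) := Finset.sum_nonneg fun c _ => apply_nonneg p _
    refine ⟨d / (∑ c, p (Pi.single c 1) + 1), by positivity, ?_⟩
    rw [div_mul_eq_mul_div, div_le_iff₀ (by positivity)]
    nlinarith
  have hclose : ∀ᶠ k in Filter.atTop, ∀ i c, ∀ j ∈ C i, ∀ l ∈ C i, |x k j c - x k l c| ≤ ε :=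
    Filter.eventually_all.2 fun i => Filter.eventually_all.2 fun c =>
      (hC i).eventually_abs_sub_le (hy c) hrefl hsymm hε
  obtain ⟨K, hK⟩ := Filter.eventually_atTop.1 (hclose.and (Filter.eventually_ge_atTop T))
  have hnbhd_eq : ∀ k, K ≤ k → ∀ i, nbhd k i = C i := by
    refine fun k hk i => ((hC i).closed k (hK k hk).2 i (hself i)).antisymm fun j hj => ?_
    simp only [hnbhd, mem_filter, mem_univ, true_and]
    calc N (x k j - x k i) ≤ ∑ c, |(x k j - x k i) c| * p (Pi.single c 1) :=
          seminorm_le_sum_abs_mul p _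
      _ ≤ ∑ c, ε * p (Pi.single c 1) := Finset.sum_le_sum fun c _ =>
          mul_le_mul_of_nonneg_right ((hK k hk).1 i c j hj i (hself i)) (apply_nonneg p _)
      _ ≤ d := by rwa [← Finset.mul_sum]
  have hnext : ∀ k, K ≤ k → ∀ i, x (k + 1) i = ((C i).card : ℝ)⁻¹ • ∑ j ∈ C i, x k j :=
    fun k hk i => by rw [← hnbhd_eq k hk i]; exact hdyn k i
  have hfix : ∀ k, K + 1 ≤ k → x (k + 1) = x k := by
    intro k hk
    obtain ⟨l, rfl⟩ := Nat.exists_eq_add_of_le' hk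
    funext i
    have hconst : ∀ j ∈ C i, x (l + (K + 1)) j = x (l + (K + 1)) i := fun j hj => by
      rw [← add_assoc, hnext (l + K) (by omega) j, hnext (l + K) (by omega) i, hclass i j hj]
    have hcard : ((C i).card : ℝ) ≠ 0 := by
      exact_mod_cast (Finset.card_pos.2 ⟨i, hself i⟩).ne'
    rw [hnext _ (by omega) i, Finset.sum_congr rfl hconst, Finset.sum_const,
      ← Nat.cast_smul_eq_nsmul ℝ, inv_smul_smul₀ hcard]
  refine ⟨K + 1, fun k hk => ?_⟩
  induction k, hk using Nat.le_induction with
  | base => rfl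
  | succ k hk ih => rw [hfix k hk, ih]
end

section
/- The multidimensional HK model with the Euclidean norm terminates in at most 2n⁴ steps, independently of the opinion dimension m: for any initial opinions x_1(0),…,x_n(0) ∈ ℝ^m there exists k* ≤ 2n⁴ such that x_i(k) = x_i(k*) for all i and all k ≥ k*. -/
open Finset

namespace HegselmannKrause

section Geodesic

variable {α : Type*}

lemma exists_geodesic {G : SimpleGraph α} {r i : α} (h : G.Reachable r i) :
    ∃ p : ℕ → α, p 0 = r ∧ p (G.dist r i) = i ∧
      (∀ a < G.dist r i, G.Adj (p a) (p (a + 1))) ∧ ∀ a ≤ G.dist r i, G.dist r (p a) = a := by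
  obtain ⟨q, hq⟩ := h.exists_walk_length_eq_dist
  refine ⟨q.getVert, q.getVert_zero, hq ▸ q.getVert_length,
    fun a ha => q.adj_getVert_succ (hq ▸ ha), fun a ha => le_antisymm ?_ ?_⟩
  · exact (SimpleGraph.dist_le (q.take a)).trans (by simp)
  · have h1 : G.dist (q.getVert a) i ≤ G.dist r i - a :=
      (SimpleGraph.dist_le (q.drop a)).trans (by simp [hq])
    have h2 := (q.take a).reachable.dist_triangle_left i
    omega

/-- A path along which a level function increases by one at every step uses each edge at most
once, so that the sum of a symmetric nonnegative function over its edges is at most half of the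
sum over all ordered pairs. -/
lemma two_mul_sum_path_le [Fintype α] {f : α → α → ℝ} (hf : ∀ i j, 0 ≤ f i j)
    (hsymm : ∀ i j, f i j = f j i) {p : ℕ → α} {k : ℕ} {lev : α → ℕ}
    (hlev : ∀ a ≤ k, lev (p a) = a) :
    2 * ∑ a ∈ range k, f (p a) (p (a + 1)) ≤ ∑ i, ∑ j, f i j := by
  classical
  let e₁ : ℕ → α × α := fun a => (p a, p (a + 1))
  let e₂ : ℕ → α × α := fun a => (p (a + 1), p a)
  have lev_eq : ∀ a ∈ range k, lev (p a) = a ∧ lev (p (a + 1)) = a + 1 := fun a ha => by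
    rw [mem_range] at ha
    exact ⟨hlev a (by omega), hlev (a + 1) (by omega)⟩
  have inj₁ : Set.InjOn e₁ (range k) := fun a ha b hb hab => by
    rw [← (lev_eq a ha).1, ← (lev_eq b hb).1]
    exact congrArg (fun q => lev q.1) hab
  have inj₂ : Set.InjOn e₂ (range k) := fun a ha b hb hab => by
    rw [← (lev_eq a ha).1, ← (lev_eq b hb).1]
    exact congrArg (fun q => lev q.2) hab
  have disj : Disjoint ((range k).image e₁) ((range k).image e₂) := by
    rw [disjoint_left]
    intro q h₁ h₂
    obtain ⟨a, ha, rfl⟩ := mem_image.1 h₁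
    obtain ⟨b, hb, hab⟩ := mem_image.1 h₂
    have := lev_eq a ha
    have := lev_eq b hb
    have h₃ : lev (p (b + 1)) = lev (p a) := congrArg (fun q => lev q.1) hab
    have h₄ : lev (p b) = lev (p (a + 1)) := congrArg (fun q => lev q.2) hab
    omega
  have hsum := sum_le_sum_of_subset_of_nonneg
    (subset_univ ((range k).image e₁ ∪ (range k).image e₂))
    (f := fun q : α × α => f q.1 q.2) (fun q _ _ => hf q.1 q.2)
  rw [sum_union disj, sum_image inj₁, sum_image inj₂, Fintype.sum_prod_type] at hsum
  have hswap : ∑ a ∈ range k, f (e₂ a).1 (e₂ a).2 = ∑ a ∈ range k, f (p a) (p (a + 1)) :=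
    sum_congr rfl fun a _ => hsymm _ _
  rw [hswap] at hsum
  linarith

end Geodesic

section Averaging

variable {ι V : Type*} [Fintype ι] [NormedAddCommGroup V] [InnerProductSpace ℝ V]

lemma sum_eq_two_mul_of_symmetrized {F G : ι → ι → ℝ} (h : ∀ i j, F i j = G i j + G j i) :
    ∑ i, ∑ j, F i j = 2 * ∑ i, ∑ j, G i j := by
  have hc : ∑ i, ∑ j, G j i = ∑ i, ∑ j, G i j := sum_comm
  simp only [h, sum_add_distrib, hc]
  ring

variable {w : ι → ι → ℝ} {z u : ι → V}

lemma sum_mul_inner_displacement (hu : ∀ i, (∑ j, w i j) • u i = ∑ j, w i j • (z i - z j))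
    (v : V) (i : ι) :
    ∑ j, w i j * inner ℝ v (z i - z j) = (∑ j, w i j) * inner ℝ v (u i) := by
  rw [← real_inner_smul_right, hu, inner_sum]
  simp only [real_inner_smul_right]

/-- The exact decrease of the Dirichlet energy under the averaging step `z ↦ z - u`. -/
lemma dirichlet_sub_dirichlet_step (hw : ∀ i j, w i j = w j i)
    (hu : ∀ i, (∑ j, w i j) • u i = ∑ j, w i j • (z i - z j)) :
    ∑ i, ∑ j, w i j * ‖z i - z j‖ ^ 2 - ∑ i, ∑ j, w i j * ‖(z i - u i) - (z j - u j)‖ ^ 2 =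
      ∑ i, ∑ j, w i j * ‖u i + u j‖ ^ 2 := by
  have key := sum_eq_two_mul_of_symmetrized
    (F := fun i j => w i j * ‖z i - z j‖ ^ 2 - w i j * ‖(z i - u i) - (z j - u j)‖ ^ 2
      - w i j * ‖u i + u j‖ ^ 2)
    (G := fun i j => 2 * (w i j * inner ℝ (u i) (z i - z j)) - w i j * (2 * ‖u i‖ ^ 2))
    (fun i j => by
      rw [hw j i]
      simp only [← real_inner_self_eq_norm_sq, inner_sub_left, inner_sub_right, inner_add_left,
        inner_add_right]
      rw [real_inner_comm (z j) (z i), real_inner_comm (u j) (u i), real_inner_comm (u i) (z i),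
        real_inner_comm (u i) (z j), real_inner_comm (u j) (z i), real_inner_comm (u j) (z j)]
      ring)
  simp only [sum_sub_distrib, ← mul_sum, ← sum_mul, sum_mul_inner_displacement hu,
    real_inner_self_eq_norm_sq] at key
  have h0 : ∑ i, (∑ j, w i j) * (2 * ‖u i‖ ^ 2) = 2 * ∑ i, (∑ j, w i j) * ‖u i‖ ^ 2 := by
    rw [mul_sum]
    exact sum_congr rfl fun i _ => by ring
  linarith

/-- A Poincaré inequality with constant `β`, for the deviation of `z` from a function `c` that is
constant along edges, bounds the Dirichlet energy by its decrease in one averaging step. -/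
lemma dirichlet_le_of_poincare (hw : ∀ i j, w i j = w j i) (hw0 : ∀ i j, 0 ≤ w i j)
    (hw1 : ∀ i j, w i j ≤ 1) (hdiag : ∀ i, w i i = 1)
    (hu : ∀ i, (∑ j, w i j) • u i = ∑ j, w i j • (z i - z j))
    {c : ι → V} (hc : ∀ i j, w i j ≠ 0 → c i = c j) {β : ℝ} (hβ : 0 < β)
    (hpoin : ∑ i, (∑ j, w i j) * ‖z i - c i‖ ^ 2 ≤ β * ∑ i, ∑ j, w i j * ‖z i - z j‖ ^ 2) :
    ∑ i, ∑ j, w i j * ‖z i - z j‖ ^ 2 ≤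
      (Fintype.card ι / 2 + β) * ∑ i, ∑ j, w i j * ‖u i + u j‖ ^ 2 := by
  set v : ι → V := fun i => z i - c i with hv
  set D := ∑ i, ∑ j, w i j * ‖z i - z j‖ ^ 2 with hD
  set T := ∑ i, ∑ j, w i j * ‖u i + u j‖ ^ 2 with hT
  have edge : ∀ i j, w i j • (z i - z j) = w i j • (v i - v j) := fun i j => by
    by_cases h : w i j = 0
    · simp [h]
    · simp [hv, hc i j h]
  have edge_inner : ∀ i j (a : V), w i j * inner ℝ a (z i - z j) =
      w i j * inner ℝ a (v i - v j) := fun i j a => by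
    rw [← real_inner_smul_right, edge, real_inner_smul_right]
  have key := sum_eq_two_mul_of_symmetrized
    (F := fun i j => w i j * ‖z i - z j‖ ^ 2 - 1 / 2 * (w i j * inner ℝ (u i + u j) (v i + v j)))
    (G := fun i j => w i j * inner ℝ (v i) (z i - z j)
      - w i j * inner ℝ (u i) (v i) + 1 / 2 * (w i j * inner ℝ (u i) (z i - z j)))
    (fun i j => by
      have h1 : w i j * ‖z i - z j‖ ^ 2 = w i j * ‖v i - v j‖ ^ 2 := by
        rw [← real_inner_self_eq_norm_sq, edge_inner, real_inner_comm, edge_inner,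
          real_inner_self_eq_norm_sq]
      rw [h1, edge_inner, edge_inner, edge_inner, edge_inner, hw j i]
      simp only [← real_inner_self_eq_norm_sq, inner_sub_left, inner_sub_right, inner_add_left,
        inner_add_right]
      rw [real_inner_comm (v j) (v i)]
      ring)
  simp only [sum_sub_distrib, sum_add_distrib, ← mul_sum, ← sum_mul,
    sum_mul_inner_displacement hu, real_inner_self_eq_norm_sq] at key
  have hcomm : ∑ i, (∑ j, w i j) * inner ℝ (v i) (u i) =
      ∑ i, (∑ j, w i j) * inner ℝ (u i) (v i) :=
    sum_congr rfl fun i _ => by rw [real_inner_comm]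
  have hU : ∑ i, (∑ j, w i j) * ‖u i‖ ^ 2 ≤ Fintype.card ι / 4 * T := by
    rw [hT, mul_sum]
    refine sum_le_sum fun i _ => ?_
    have hdeg : ∑ j, w i j ≤ Fintype.card ι := by
      simpa using sum_le_card_nsmul univ (w i) 1 fun j _ => hw1 i j
    have hi : 4 * ‖u i‖ ^ 2 ≤ ∑ j, w i j * ‖u i + u j‖ ^ 2 := by
      have := single_le_sum (f := fun j => w i j * ‖u i + u j‖ ^ 2)
        (fun j _ => mul_nonneg (hw0 i j) (sq_nonneg _)) (mem_univ i)
      have h2 : ‖u i + u i‖ = 2 * ‖u i‖ := by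
        rw [← two_smul ℝ, norm_smul]
        simp
      simp only [hdiag, h2] at this
      linarith
    have hn : (0 : ℝ) ≤ Fintype.card ι := Nat.cast_nonneg _
    nlinarith [mul_le_mul_of_nonneg_right hdeg (sq_nonneg ‖u i‖),
      mul_le_mul_of_nonneg_left hi hn]
  have hQ : ∑ i, ∑ j, w i j * ‖v i + v j‖ ^ 2 ≤ 4 * (β * D) := by
    have h1 : ∑ i, ∑ j, w i j * ‖v i + v j‖ ^ 2 ≤
        ∑ i, ∑ j, w i j * (2 * ‖v i‖ ^ 2 + 2 * ‖v j‖ ^ 2) :=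
      sum_le_sum fun i _ => sum_le_sum fun j _ => mul_le_mul_of_nonneg_left (by
        nlinarith [parallelogram_law_with_norm ℝ (v i) (v j), mul_self_nonneg ‖v i - v j‖])
        (hw0 i j)
    rw [sum_eq_two_mul_of_symmetrized (F := fun i j => w i j * (2 * ‖v i‖ ^ 2 + 2 * ‖v j‖ ^ 2))
      (G := fun i j => 2 * (w i j * ‖v i‖ ^ 2)) (fun i j => by rw [hw j i]; ring)] at h1
    simp only [← mul_sum, ← sum_mul] at h1
    linarith
  have hcross : ∑ i, ∑ j, w i j * inner ℝ (u i + u j) (v i + v j) ≤ β * T + D := by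
    have h1 : ∑ i, ∑ j, w i j * inner ℝ (u i + u j) (v i + v j) ≤
        ∑ i, ∑ j, (β * (w i j * ‖u i + u j‖ ^ 2) + (4 * β)⁻¹ * (w i j * ‖v i + v j‖ ^ 2)) := by
      refine sum_le_sum fun i _ => sum_le_sum fun j _ => ?_
      have hpt : inner ℝ (u i + u j) (v i + v j) ≤
          β * ‖u i + u j‖ ^ 2 + (4 * β)⁻¹ * ‖v i + v j‖ ^ 2 := by
        refine (real_inner_le_norm _ _).trans ?_
        have : β * ‖u i + u j‖ ^ 2 + (4 * β)⁻¹ * ‖v i + v j‖ ^ 2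
            - ‖u i + u j‖ * ‖v i + v j‖ =
            β * (‖u i + u j‖ - (2 * β)⁻¹ * ‖v i + v j‖) ^ 2 := by
          field_simp
          ring
        have := mul_nonneg hβ.le (sq_nonneg (‖u i + u j‖ - (2 * β)⁻¹ * ‖v i + v j‖))
        linarith
      nlinarith [mul_le_mul_of_nonneg_left hpt (hw0 i j)]
    simp only [sum_add_distrib, ← mul_sum] at h1
    have h2 := mul_le_mul_of_nonneg_left hQ (inv_nonneg.2 (by positivity : 0 ≤ 4 * β))
    have h3 : (4 * β)⁻¹ * (4 * (β * D)) = D := by field_simp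
    linarith
  linarith

end Averaging

section Model

variable {ι V : Type*} [NormedAddCommGroup V]

/-- The indicator of mutual trust. -/
noncomputable def weight (d : ℝ) (z : ι → V) (i j : ι) : ℝ :=
  if ‖z j - z i‖ ≤ d then 1 else 0

/-- Distinct agents are adjacent when they trust each other. -/
def trustGraph (d : ℝ) (z : ι → V) : SimpleGraph ι where
  Adj i j := i ≠ j ∧ ‖z j - z i‖ ≤ d
  symm := ⟨fun i j h => ⟨h.1.symm, norm_sub_rev (z j) (z i) ▸ h.2⟩⟩
  loopless := ⟨fun _ h => h.1 rfl⟩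

variable {d : ℝ} {z : ι → V}

lemma weight_comm (i j : ι) : weight d z i j = weight d z j i := by
  simp only [weight, norm_sub_rev (z j) (z i)]

lemma weight_nonneg (i j : ι) : 0 ≤ weight d z i j := by
  unfold weight; split_ifs <;> norm_num

lemma weight_le_one (i j : ι) : weight d z i j ≤ 1 := by
  unfold weight; split_ifs <;> norm_num

lemma weight_self (hd : 0 < d) (i : ι) : weight d z i i = 1 := by
  simp [weight, hd.le]

lemma weight_of_adj {i j : ι} (h : (trustGraph d z).Adj i j) : weight d z i j = 1 :=
  if_pos h.2

lemma reachable_of_norm_le {i j : ι} (h : ‖z j - z i‖ ≤ d) : (trustGraph d z).Reachable i j := by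
  by_cases hij : i = j
  · exact hij ▸ SimpleGraph.Reachable.refl _
  · exact SimpleGraph.Adj.reachable ⟨hij, h⟩

variable [Fintype ι]

/-- The energy: the sum of the squared distances, truncated at the confidence range. -/
noncomputable def energy (d : ℝ) (z : ι → V) : ℝ :=
  ∑ i, ∑ j, min (‖z i - z j‖ ^ 2) (d ^ 2)

lemma energy_nonneg : 0 ≤ energy d z :=
  sum_nonneg fun _ _ => sum_nonneg fun _ _ => le_min (sq_nonneg _) (sq_nonneg _)

lemma energy_le : energy d z ≤ Fintype.card ι * (Fintype.card ι - 1) * d ^ 2 := by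
  classical
  have h : ∀ i, ∑ j, min (‖z i - z j‖ ^ 2) (d ^ 2) ≤ (Fintype.card ι - 1) * d ^ 2 := fun i => by
    have h1 : ∑ j, min (‖z i - z j‖ ^ 2) (d ^ 2) ≤ ∑ j, if j = i then 0 else d ^ 2 := by
      refine sum_le_sum fun j _ => ?_
      split_ifs with hj
      · simp [hj]
      · exact min_le_right _ _
    refine h1.trans (le_of_eq ?_)
    have h2 : ∀ j, (if j = i then 0 else d ^ 2) = d ^ 2 - if j = i then d ^ 2 else 0 := fun j => by
      split_ifs <;> simp
    simp only [h2, sum_sub_distrib, sum_ite_eq', sum_const, card_univ, mem_univ, if_true,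
      nsmul_eq_mul]
    ring
  calc energy d z ≤ ∑ _i : ι, (Fintype.card ι - 1) * d ^ 2 := sum_le_sum fun i _ => h i
    _ = _ := by simp; ring

/-- A normalised energy plus the number of distinct opinions. -/
noncomputable def potential (d : ℝ) (z : ι → V) : ℝ :=
  2 * (Fintype.card ι : ℝ) ^ 2 / d ^ 2 * energy d z + (Set.range z).ncard

lemma potential_nonneg : 0 ≤ potential d z :=
  add_nonneg (mul_nonneg (by positivity) energy_nonneg) (Nat.cast_nonneg _)

lemma potential_le (hd : 0 < d) : potential d z ≤ 2 * (Fintype.card ι : ℝ) ^ 4 := by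
  have h1 : (Set.range z).ncard ≤ Fintype.card ι := by
    rw [← Set.image_univ, ← Nat.card_eq_fintype_card, ← Set.ncard_univ]
    exact Set.ncard_image_le Set.finite_univ
  have h2 : ((Set.range z).ncard : ℝ) ≤ Fintype.card ι := Nat.cast_le.2 h1
  have h3 : 2 * (Fintype.card ι : ℝ) ^ 2 / d ^ 2 * energy d z ≤
      2 * (Fintype.card ι : ℝ) ^ 2 * (Fintype.card ι * (Fintype.card ι - 1)) := by
    rw [div_mul_eq_mul_div, div_le_iff₀ (by positivity), mul_assoc _ _ (d ^ 2)]
    gcongr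
    exact energy_le
  have h4 : (Fintype.card ι : ℝ) ≤ (Fintype.card ι : ℝ) ^ 3 := by
    exact_mod_cast Nat.le_self_pow (by norm_num) (Fintype.card ι)
  have h5 : (0 : ℝ) ≤ (Fintype.card ι : ℝ) ^ 3 := by positivity
  unfold potential
  nlinarith

lemma sum_weight (i : ι) :
    ∑ j, weight d z i j = (univ.filter (fun j => ‖z j - z i‖ ≤ d)).card := by
  simp [weight]

lemma two_mul_sum_geodesic_le {p : ℕ → ι} {k : ℕ} {lev : ι → ℕ}
    (hadj : ∀ a < k, (trustGraph d z).Adj (p a) (p (a + 1))) (hlev : ∀ a ≤ k, lev (p a) = a) :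
    2 * ∑ a ∈ range k, ‖z (p (a + 1)) - z (p a)‖ ^ 2 ≤
      ∑ i, ∑ j, weight d z i j * ‖z i - z j‖ ^ 2 := by
  refine le_trans (le_of_eq ?_) (two_mul_sum_path_le
    (f := fun i j => weight d z i j * ‖z i - z j‖ ^ 2)
    (fun i j => mul_nonneg (weight_nonneg i j) (sq_nonneg _))
    (fun i j => by rw [weight_comm, norm_sub_rev]) hlev)
  congr 1
  refine sum_congr rfl fun a ha => ?_
  rw [weight_of_adj (hadj a (mem_range.1 ha)), one_mul, norm_sub_rev]

lemma norm_sub_sq_le_dist_mul_dirichlet {r i : ι} (h : (trustGraph d z).Reachable r i) :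
    ‖z i - z r‖ ^ 2 ≤ (trustGraph d z).dist r i / 2 *
      ∑ i, ∑ j, weight d z i j * ‖z i - z j‖ ^ 2 := by
  obtain ⟨p, hp0, hpk, hadj, hlev⟩ := exists_geodesic h
  set k := (trustGraph d z).dist r i
  have h1 := two_mul_sum_geodesic_le hadj hlev
  have h2 : ‖z i - z r‖ ≤ ∑ a ∈ range k, ‖z (p (a + 1)) - z (p a)‖ := by
    rw [← hpk, ← hp0, ← sum_range_sub (fun a => z (p a))]
    exact norm_sum_le _ _
  have h3 : ‖z i - z r‖ ^ 2 ≤ k * ∑ a ∈ range k, ‖z (p (a + 1)) - z (p a)‖ ^ 2 := by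
    refine (pow_le_pow_left₀ (norm_nonneg _) h2 2).trans ?_
    simpa using sq_sum_le_card_mul_sum_sq (s := range k)
      (f := fun a => ‖z (p (a + 1)) - z (p a)‖)
  nlinarith [mul_le_mul_of_nonneg_left h1 (Nat.cast_nonneg (α := ℝ) k)]

/-- Long geodesics force a large Dirichlet energy, as two consecutive edges have total length
more than `d`. -/
lemma dist_mul_sq_le_dirichlet (hd : 0 < d) {r i : ι} (h : (trustGraph d z).Reachable r i)
    (hk : 2 ≤ (trustGraph d z).dist r i) :
    (trustGraph d z).dist r i * d ^ 2 ≤ 3 * ∑ i, ∑ j, weight d z i j * ‖z i - z j‖ ^ 2 := by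
  obtain ⟨p, -, -, hadj, hlev⟩ := exists_geodesic h
  set k := (trustGraph d z).dist r i
  have hsum := two_mul_sum_geodesic_le hadj hlev
  have far : ∀ a, a + 2 ≤ k → d < ‖z (p (a + 2)) - z (p a)‖ := fun a ha => by
    by_contra! hle
    have l0 := hlev a (by omega)
    have l2 := hlev (a + 2) ha
    have hne : p a ≠ p (a + 2) := fun h => by rw [h] at l0; omega
    have := SimpleGraph.Adj.diff_dist_adj (G := trustGraph d z) (u := r)
      (v := p a) (w := p (a + 2)) ⟨hne, hle⟩
    omega
  have pairs : ∀ q, 2 * q ≤ k →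
      q * (d ^ 2 / 2) ≤ ∑ a ∈ range (2 * q), ‖z (p (a + 1)) - z (p a)‖ ^ 2 := by
    intro q
    induction q with
    | zero => simp
    | succ q ih =>
      intro hq
      rw [show 2 * (q + 1) = 2 * q + 1 + 1 by ring, sum_range_succ, sum_range_succ]
      have h1 := ih (by omega)
      have h2 := far (2 * q) (by omega)
      have h3 := norm_sub_le_norm_sub_add_norm_sub (z (p (2 * q + 2))) (z (p (2 * q + 1)))
        (z (p (2 * q)))
      have h4 : d ^ 2 ≤ (‖z (p (2 * q + 2)) - z (p (2 * q + 1))‖ +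
          ‖z (p (2 * q + 1)) - z (p (2 * q))‖) ^ 2 := by gcongr; linarith
      push_cast
      nlinarith [sq_nonneg (‖z (p (2 * q + 2)) - z (p (2 * q + 1))‖ -
          ‖z (p (2 * q + 1)) - z (p (2 * q))‖)]
  have h1 := pairs (k / 2) (by omega)
  have h2 : ∑ a ∈ range (2 * (k / 2)), ‖z (p (a + 1)) - z (p a)‖ ^ 2 ≤
      ∑ a ∈ range k, ‖z (p (a + 1)) - z (p a)‖ ^ 2 :=
    sum_le_sum_of_subset_of_nonneg (range_subset_range.2 (by omega)) fun _ _ _ => sq_nonneg _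
  have h3 : (k : ℝ) ≤ 3 * (k / 2 : ℕ) := by exact_mod_cast (by omega : k ≤ 3 * (k / 2))
  nlinarith [mul_le_mul_of_nonneg_right h3 (sq_nonneg d)]

variable [InnerProductSpace ℝ V]

/-- One step of the dynamics. -/
noncomputable def step (d : ℝ) (z : ι → V) (i : ι) : V :=
  (((univ.filter (fun j => ‖z j - z i‖ ≤ d)).card : ℝ))⁻¹ •
    ∑ j ∈ univ.filter (fun j => ‖z j - z i‖ ≤ d), z j

lemma sum_weight_smul_sub_step (hd : 0 < d) (i : ι) :
    (∑ j, weight d z i j) • (z i - step d z i) = ∑ j, weight d z i j • (z i - z j) := by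
  have hpos : ((univ.filter (fun j => ‖z j - z i‖ ≤ d)).card : ℝ) ≠ 0 :=
    Nat.cast_ne_zero.2 (card_ne_zero_of_mem (mem_filter.2 ⟨mem_univ i, by simp [hd.le]⟩))
  simp only [smul_sub, sum_sub_distrib, ← sum_smul]
  rw [sum_weight, step, smul_inv_smul₀ hpos, sum_filter]
  simp only [weight, ite_smul, one_smul, zero_smul]

/-- The energy decreases by at least the dissipation of the averaging step. -/
lemma energy_step_add_le (hd : 0 < d) :
    energy d (step d z) + ∑ i, ∑ j, weight d z i j *
      ‖(z i - step d z i) + (z j - step d z j)‖ ^ 2 ≤ energy d z := by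
  rw [← dirichlet_sub_dirichlet_step weight_comm (sum_weight_smul_sub_step hd)]
  simp only [sub_sub_cancel]
  have h : ∀ i j, min (‖step d z i - step d z j‖ ^ 2) (d ^ 2) + weight d z i j * ‖z i - z j‖ ^ 2
      - weight d z i j * ‖step d z i - step d z j‖ ^ 2 ≤ min (‖z i - z j‖ ^ 2) (d ^ 2) := by
    intro i j
    unfold weight
    split_ifs with hij
    · rw [min_eq_left (a := ‖z i - z j‖ ^ 2)]
      · linarith [min_le_left (‖step d z i - step d z j‖ ^ 2) (d ^ 2)]
      · rw [norm_sub_rev]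
        gcongr
    · rw [min_eq_right (a := ‖z i - z j‖ ^ 2)]
      · linarith [min_le_right (‖step d z i - step d z j‖ ^ 2) (d ^ 2)]
      · rw [norm_sub_rev]
        gcongr
        exact (not_le.1 hij).le
  have := sum_le_sum fun i (_ : i ∈ univ) => sum_le_sum fun j (_ : j ∈ univ) => h i j
  simp only [sum_add_distrib, sum_sub_distrib] at this
  unfold energy
  linarith

lemma energy_step_le (hd : 0 < d) : energy d (step d z) ≤ energy d z :=
  (le_add_of_nonneg_right (sum_nonneg fun i _ => sum_nonneg fun j _ =>
    mul_nonneg (weight_nonneg i j) (sq_nonneg _))).trans (energy_step_add_le hd)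

/-- If some component of the trust graph is not a clique, the energy drops by a definite
amount. -/
lemma energy_step_add_le_of_not_clique (hd : 0 < d) {r₀ i₀ : ι}
    (h₀ : (trustGraph d z).Reachable r₀ i₀) (hk₀ : 2 ≤ (trustGraph d z).dist r₀ i₀) :
    energy d (step d z) + d ^ 2 / (2 * (Fintype.card ι : ℝ) ^ 2) ≤ energy d z := by
  classical
  set G := trustGraph d z with hG
  obtain ⟨⟨r, i⟩, hmem, hmax⟩ := exists_max_image
    (univ.filter fun q : ι × ι => G.Reachable q.1 q.2) (fun q => G.dist q.1 q.2)
    ⟨(r₀, i₀), by simpa using h₀⟩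
  have hri : G.Reachable r i := (mem_filter.1 hmem).2
  have hmax' : ∀ a b, G.Reachable a b → G.dist a b ≤ G.dist r i := fun a b hab =>
    hmax (a, b) (by simpa using hab)
  have hk : 2 ≤ G.dist r i := hk₀.trans (hmax' _ _ h₀)
  have hD := dist_mul_sq_le_dirichlet hd hri hk
  rw [← hG] at hD
  set k := G.dist r i
  set D := ∑ i, ∑ j, weight d z i j * ‖z i - z j‖ ^ 2 with hDdef
  have hD0 : 0 ≤ D := sum_nonneg fun i _ => sum_nonneg fun j _ =>
    mul_nonneg (weight_nonneg i j) (sq_nonneg _)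
  have hcard : 2 ≤ Fintype.card ι := by
    have hne : r ≠ i := fun h => by simp [k, h] at hk
    exact Fintype.one_lt_card_iff.2 ⟨r, i, hne⟩
  set n : ℝ := (Fintype.card ι : ℝ) with hn
  have hn2 : (2 : ℝ) ≤ n := Nat.ofNat_le_cast.2 hcard
  have hkR : (2 : ℝ) ≤ k := by exact_mod_cast hk
  let root : ι → ι := fun i => (G.connectedComponentMk i).out
  have hroot : ∀ i, G.Reachable (root i) i := fun i =>
    SimpleGraph.ConnectedComponent.exact (Quot.out_eq (G.connectedComponentMk i))
  have hpoin : ∑ i, (∑ j, weight d z i j) * ‖z i - z (root i)‖ ^ 2 ≤ (k * n ^ 2 / 2) * D := by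
    have h1 : ∀ i ∈ univ, (∑ j, weight d z i j) * ‖z i - z (root i)‖ ^ 2 ≤ n * (k / 2 * D) := by
      intro i _
      have hdeg : ∑ j, weight d z i j ≤ n := by
        simpa using sum_le_card_nsmul univ (weight d z i) 1 fun j _ => weight_le_one i j
      have hle : ‖z i - z (root i)‖ ^ 2 ≤ k / 2 * D := by
        refine (norm_sub_sq_le_dist_mul_dirichlet (hroot i)).trans ?_
        gcongr
        exact hmax' _ _ (hroot i)
      gcongr
    refine (sum_le_card_nsmul _ _ _ h1).trans (le_of_eq ?_)
    rw [nsmul_eq_mul, card_univ]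
    ring
  have hgap := dirichlet_le_of_poincare weight_comm weight_nonneg weight_le_one
    (weight_self hd) (sum_weight_smul_sub_step hd) (c := fun i => z (root i)) (fun i j hij => by
      have hij' : ‖z j - z i‖ ≤ d := by
        by_contra h
        exact hij (if_neg h)
      have : G.connectedComponentMk i = G.connectedComponentMk j :=
        SimpleGraph.ConnectedComponent.sound (reachable_of_norm_le hij')
      simp only [root, this]) (by positivity) hpoin
  refine le_trans ?_ (energy_step_add_le hd)
  rw [← hn, ← hDdef] at hgap
  set T := ∑ i, ∑ j, weight d z i j * ‖(z i - step d z i) + (z j - step d z j)‖ ^ 2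
  gcongr
  rw [div_le_iff₀ (by positivity)]
  have h3 : k * d ^ 2 ≤ 3 * ((n / 2 + k * n ^ 2 / 2) * T) := by linarith
  have hT : 0 ≤ T := sum_nonneg fun i _ => sum_nonneg fun j _ =>
    mul_nonneg (weight_nonneg i j) (sq_nonneg _)
  have h4 : 3 * (n / 2 + k * n ^ 2 / 2) ≤ k * (2 * n ^ 2) := by nlinarith
  have h5 : k * d ^ 2 ≤ k * (T * (2 * n ^ 2)) := by
    nlinarith [mul_le_mul_of_nonneg_right h4 hT]
  exact le_of_mul_le_mul_left h5 (by linarith)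

lemma step_eq_step_of_eq {i j : ι} (h : z i = z j) : step d z i = step d z j := by
  simp only [step, h]

lemma exists_step_eq_comp : ∃ f : V → V, step d z = f ∘ z :=
  (Function.factorsThrough_iff _).1 fun _ _ => step_eq_step_of_eq

lemma ncard_range_step_le : (Set.range (step d z)).ncard ≤ (Set.range z).ncard := by
  obtain ⟨f, hf⟩ := exists_step_eq_comp (d := d) (z := z)
  rw [hf, Set.range_comp]
  exact Set.ncard_image_le (Set.finite_range z)

lemma eq_of_step_eq_of_ncard_le (h : (Set.range z).ncard ≤ (Set.range (step d z)).ncard) {i j : ι}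
    (hij : step d z i = step d z j) : z i = z j := by
  obtain ⟨f, hf⟩ := exists_step_eq_comp (d := d) (z := z)
  have heq := h.antisymm ncard_range_step_le
  rw [hf, Set.range_comp] at heq
  rw [hf] at hij
  exact Set.injOn_of_ncard_image_eq heq.symm (Set.finite_range z) ⟨i, rfl⟩ ⟨j, rfl⟩ hij

/-- If all components of the trust graph are cliques, then a step which does not identify further
opinions leaves all opinions unchanged. -/
lemma step_eq_self_of_clique (hd : 0 < d)
    (hclique : ∀ r i, (trustGraph d z).Reachable r i → (trustGraph d z).dist r i < 2)
    (h : (Set.range z).ncard ≤ (Set.range (step d z)).ncard) : step d z = z := by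
  have close : ∀ i j, (trustGraph d z).Reachable i j → ‖z j - z i‖ ≤ d := fun i j hij => by
    by_cases hne : i = j
    · simp [hne, hd.le]
    · have := hclique i j hij
      have := hij.pos_dist_of_ne hne
      exact (SimpleGraph.dist_eq_one_iff_adj.1 (by omega : (trustGraph d z).dist i j = 1)).2
  have same : ∀ i j, ‖z j - z i‖ ≤ d → z i = z j := fun i j hij => by
    refine eq_of_step_eq_of_ncard_le h ?_
    have hr := reachable_of_norm_le hij
    have hset : univ.filter (fun k => ‖z k - z i‖ ≤ d) =
        univ.filter (fun k => ‖z k - z j‖ ≤ d) :=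
      filter_congr fun k _ => ⟨fun hk => close _ _ (hr.symm.trans (reachable_of_norm_le hk)),
        fun hk => close _ _ (hr.trans (reachable_of_norm_le hk))⟩
    simp only [step, hset]
  funext i
  have hs := sum_weight_smul_sub_step (z := z) hd i
  have h0 : ∑ j, weight d z i j • (z i - z j) = 0 := sum_eq_zero fun j _ => by
    unfold weight
    split_ifs with hij
    · simp [same i j hij]
    · simp
  have hpos : 0 < ∑ j, weight d z i j :=
    (weight_self (z := z) hd i ▸ one_pos).trans_le
      (single_le_sum (fun j _ => weight_nonneg i j) (mem_univ i))
  rw [h0, smul_eq_zero] at hs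
  exact (sub_eq_zero.1 (hs.resolve_left hpos.ne')).symm

lemma potential_step_add_one_le (hd : 0 < d) (hne : step d z ≠ z) :
    potential d (step d z) + 1 ≤ potential d z := by
  have hι : Nonempty ι := by
    by_contra h
    rw [not_nonempty_iff] at h
    exact hne (Subsingleton.elim _ _)
  have hn : (0 : ℝ) < Fintype.card ι := Nat.cast_pos.2 Fintype.card_pos
  have hc : (0 : ℝ) < 2 * (Fintype.card ι : ℝ) ^ 2 / d ^ 2 := by positivity
  unfold potential
  by_cases hclique : ∀ r i, (trustGraph d z).Reachable r i → (trustGraph d z).dist r i < 2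
  · have h1 : (Set.range (step d z)).ncard + 1 ≤ (Set.range z).ncard := by
      by_contra h
      exact hne (step_eq_self_of_clique hd hclique (by omega))
    have h2 : ((Set.range (step d z)).ncard : ℝ) + 1 ≤ (Set.range z).ncard := by exact_mod_cast h1
    have h3 := mul_le_mul_of_nonneg_left (energy_step_le (z := z) hd) hc.le
    linarith
  · push Not at hclique
    obtain ⟨r, i, hri, hk⟩ := hclique
    have h2 : ((Set.range (step d z)).ncard : ℝ) ≤ (Set.range z).ncard :=
      Nat.cast_le.2 ncard_range_step_le
    have h3 := mul_le_mul_of_nonneg_left (energy_step_add_le_of_not_clique hd hri hk) hc.le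
    have h4 : 2 * (Fintype.card ι : ℝ) ^ 2 / d ^ 2 * (d ^ 2 / (2 * (Fintype.card ι : ℝ) ^ 2)) =
        1 := by
      field_simp
    linarith

end Model

end HegselmannKrause

open HegselmannKrause

/-- **Termination of the Euclidean multidimensional HK model in `2n⁴` steps.**
The multidimensional HK model with the Euclidean norm terminates in at most
`2n⁴` steps, independently of the dimension `m` of the opinion space. -/
theorem hk_multidim_terminates_n4 (n m : ℕ) (d : ℝ) (hd : 0 < d)
    (x : ℕ → Fin n → EuclideanSpace ℝ (Fin m))
    (hdyn : ∀ k i, x (k + 1) i =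
      (((univ.filter (fun j => ‖x k j - x k i‖ ≤ d)).card : ℝ))⁻¹ •
        ∑ j ∈ univ.filter (fun j => ‖x k j - x k i‖ ≤ d), x k j) :
    ∃ kstar : ℕ, kstar ≤ 2 * n ^ 4 ∧ ∀ k, kstar ≤ k → x k = x kstar := by
  have hstep : ∀ k, x (k + 1) = step d (x k) := fun k => funext (hdyn k)
  obtain ⟨k₀, hk₀, hfix⟩ : ∃ k₀ ≤ 2 * n ^ 4, x (k₀ + 1) = x k₀ := by
    by_contra! hne
    have hdec : ∀ k ≤ 2 * n ^ 4 + 1, potential d (x k) + k ≤ potential d (x 0) := by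
      intro k
      induction k with
      | zero => simp
      | succ k ih =>
        intro hk
        have h1 := potential_step_add_one_le hd (hstep k ▸ hne k (by omega))
        rw [← hstep] at h1
        push_cast
        linarith [ih (by omega)]
    have h1 := hdec _ le_rfl
    have h2 := potential_le (z := x 0) hd
    have h3 := potential_nonneg (d := d) (z := x (2 * n ^ 4 + 1))
    rw [Fintype.card_fin] at h2
    push_cast at h1
    linarith
  refine ⟨k₀, hk₀, fun k hk => ?_⟩
  induction k, hk using Nat.le_induction with
  | base => rfl
  | succ k _ ih => rw [hstep, ih, ← hstep, hfix]
end

section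
/- For any solution x(·) of the multidimensional HK model with the Euclidean norm and any k = 0,1,2,…, the energy function E satisfies E(x(k)) − E(x(k+1)) ≥ 4 Σ_{i=1}^n |x_i(k+1) − x_i(k)|². In particular, E is non-increasing along trajectories of the HK model. -/
open Finset

/-- The sum of the deviations from the mean of a family over a finite set vanishes. -/
lemma sum_sub_mean_eq_zero {ι V : Type*} [AddCommGroup V] [Module ℝ V]
    (s : Finset ι) (hs : s.Nonempty) (f : ι → V) :
    ∑ j ∈ s, (f j - ((s.card : ℝ))⁻¹ • ∑ l ∈ s, f l) = 0 := by
  have hc : (s.card : ℝ) ≠ 0 := by exact_mod_cast hs.card_pos.ne'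
  rw [sum_sub_distrib, sum_const, ← Nat.cast_smul_eq_nsmul ℝ, smul_smul, mul_inv_cancel₀ hc,
    one_smul, sub_self]

/-- Polarization of the change of a squared distance when both endpoints move. -/
lemma norm_sub_sq_sub_norm_sub_sq {V : Type*} [NormedAddCommGroup V] [InnerProductSpace ℝ V]
    (p q p' q' : V) :
    ‖p - q‖ ^ 2 - ‖p' - q'‖ ^ 2 = ‖(p' - p) + (q' - q)‖ ^ 2
      + 2 * inner ℝ (q - p') (p' - p) + 2 * inner ℝ (p - q') (q' - q) := by
  simp only [← real_inner_self_eq_norm_sq, inner_add_left, inner_add_right, inner_sub_left,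
    inner_sub_right]
  rw [real_inner_comm p q, real_inner_comm p' q', real_inner_comm p p', real_inner_comm q q',
    real_inner_comm p q', real_inner_comm q p']
  ring

/-- Weighted by a symmetric neighbourhood relation, the squared distances drop by at least
four times the squared displacements when every point moves to the mean of its neighbours. -/
lemma four_mul_sum_norm_sq_le_of_mean {ι V : Type*} [Fintype ι] [NormedAddCommGroup V]
    [InnerProductSpace ℝ V] (r : ι → ι → Prop) [∀ i j, Decidable (r i j)]
    (hrefl : ∀ i, r i i) (hsymm : ∀ i j, r i j ↔ r j i) (y z : ι → V)
    (hz : ∀ i, ∑ j ∈ univ.filter (r i), (y j - z i) = 0) :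
    4 * ∑ i, ‖z i - y i‖ ^ 2 ≤
      ∑ i, ∑ j, if r i j then ‖y i - y j‖ ^ 2 - ‖z i - z j‖ ^ 2 else 0 := by
  have key : ∑ i, ∑ j, (if r i j then inner ℝ (y j - z i) (z i - y i) else 0) = 0 := by
    refine sum_eq_zero fun i _ => ?_
    rw [← sum_filter, ← sum_inner, hz, inner_zero_left]
  have key' : ∑ i, ∑ j, (if r i j then inner ℝ (y i - z j) (z j - y j) else 0) = 0 := by
    refine sum_comm.trans (Eq.trans ?_ key)
    refine sum_congr rfl fun i _ => sum_congr rfl fun j _ => ?_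
    simp only [hsymm j i]
  have split : ∑ i, ∑ j, (if r i j then ‖y i - y j‖ ^ 2 - ‖z i - z j‖ ^ 2 else 0) =
      ∑ i, ∑ j, (if r i j then ‖(z i - y i) + (z j - y j)‖ ^ 2 else 0)
      + 2 * ∑ i, ∑ j, (if r i j then inner ℝ (y j - z i) (z i - y i) else 0)
      + 2 * ∑ i, ∑ j, (if r i j then inner ℝ (y i - z j) (z j - y j) else 0) := by
    simp only [mul_sum, ← sum_add_distrib]
    refine sum_congr rfl fun i _ => sum_congr rfl fun j _ => ?_
    split_ifs
    · exact norm_sub_sq_sub_norm_sub_sq _ _ _ _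
    · simp
  rw [split, key, key', mul_zero, add_zero, add_zero, mul_sum]
  refine sum_le_sum fun i _ => ?_
  calc 4 * ‖z i - y i‖ ^ 2
      = if r i i then ‖(z i - y i) + (z i - y i)‖ ^ 2 else 0 := by
        rw [if_pos (hrefl i), ← two_smul ℝ, norm_smul, mul_pow]
        norm_num
    _ ≤ ∑ j, (if r i j then ‖(z i - y i) + (z j - y j)‖ ^ 2 else 0) :=
        single_le_sum (f := fun j => if r i j then ‖(z i - y i) + (z j - y j)‖ ^ 2 else 0)
          (fun j _ => by positivity) (mem_univ i)

/-- **Energy decrease along the HK dynamics (Roozbehani et al.).**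
For the multidimensional HK model with the Euclidean norm, the energy
function `E(x) = ∑_{i,j} min(‖x i − x j‖², d²)` satisfies
`E(x(k)) − E(x(k+1)) ≥ 4 ∑ᵢ ‖xᵢ(k+1) − xᵢ(k)‖²` at every step `k`;
in particular `E` is non-increasing along trajectories. -/
theorem hk_energy_decrease (n m : ℕ) (d : ℝ) (hd : 0 < d)
    (x : ℕ → Fin n → EuclideanSpace ℝ (Fin m))
    (hdyn : ∀ k i, x (k + 1) i =
      (((univ.filter (fun j => ‖x k j - x k i‖ ≤ d)).card : ℝ))⁻¹ •
        ∑ j ∈ univ.filter (fun j => ‖x k j - x k i‖ ≤ d), x k j)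
    (E : (Fin n → EuclideanSpace ℝ (Fin m)) → ℝ)
    (hE : ∀ y, E y = ∑ i, ∑ j, min (‖y i - y j‖ ^ 2) (d ^ 2)) :
    ∀ k, 4 * ∑ i, ‖x (k + 1) i - x k i‖ ^ 2 ≤ E (x k) - E (x (k + 1)) := by
  intro k
  refine (four_mul_sum_norm_sq_le_of_mean (fun i j => ‖x k j - x k i‖ ≤ d) (by simp [hd.le])
    (fun i j => by rw [norm_sub_rev]) (x k) (x (k + 1)) fun i => ?_).trans ?_
  · rw [hdyn]
    exact sum_sub_mean_eq_zero _ ⟨i, by simp [hd.le]⟩ _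
  · simp only [hE, ← sum_sub_distrib]
    refine sum_le_sum fun i _ => sum_le_sum fun j _ => ?_
    rw [norm_sub_rev (x k j)]
    split_ifs with h
    · rw [min_eq_left (pow_le_pow_left₀ (norm_nonneg _) h 2)]
      exact sub_le_sub_left (min_le_left _ _) _
    · rw [min_eq_right (pow_le_pow_left₀ hd.le (not_le.mp h).le 2)]
      exact sub_nonneg.mpr (min_le_right _ _)
end

section
/- For any solution x(·) of the multidimensional HK model with the Euclidean norm, the total kinetic 2-energy is bounded by the initial energy: Σ_{k=0}^∞ Σ_{i=1}^n |x_i(k+1) − x_i(k)|² ≤ E(x(0)) ≤ d² n (n−1). -/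
open Finset

/-- If each `v i` is the weighted mean displacement of `x i` for symmetric weights `a`, then moving
`x` by `v` decreases the weighted sum of squared distances by `∑ᵢⱼ aᵢⱼ ‖vᵢ + vⱼ‖²`. -/
theorem sum_mul_norm_sub_sq_sub_eq {ι V : Type*} [Fintype ι] [NormedAddCommGroup V]
    [InnerProductSpace ℝ V] (a : ι → ι → ℝ) (ha : ∀ i j, a i j = a j i) (x v : ι → V)
    (hv : ∀ i, ∑ j, a i j • (x j - x i - v i) = 0) :
    ∑ i, ∑ j, a i j * (‖x i - x j‖ ^ 2 - ‖(x i + v i) - (x j + v j)‖ ^ 2) =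
      ∑ i, ∑ j, a i j * ‖v i + v j‖ ^ 2 := by
  have key : ∀ i j, ‖x i - x j‖ ^ 2 - ‖(x i + v i) - (x j + v j)‖ ^ 2 =
      ‖v i + v j‖ ^ 2 + 2 * inner ℝ (x j - x i - v i) (v i)
        + 2 * inner ℝ (x i - x j - v j) (v j) := by
    intro i j
    simp only [← real_inner_self_eq_norm_sq, inner_sub_left, inner_sub_right, inner_add_left,
      inner_add_right]
    rw [real_inner_comm (x i) (v i), real_inner_comm (x i) (v j), real_inner_comm (x j) (v i),
      real_inner_comm (x j) (v j), real_inner_comm (v j) (v i)]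
    ring
  have zero : ∑ i, ∑ j, a i j * (2 * inner ℝ (x j - x i - v i) (v i)) = 0 := by
    refine sum_eq_zero fun i _ => ?_
    have h : inner ℝ (∑ j, a i j • (x j - x i - v i)) (v i) = 0 := by rw [hv i, inner_zero_left]
    rw [sum_inner] at h
    simp only [real_inner_smul_left] at h
    simp only [mul_left_comm _ (2 : ℝ), ← mul_sum, h, mul_zero]
  have zero' : ∑ i, ∑ j, a i j * (2 * inner ℝ (x i - x j - v j) (v j)) = 0 := by
    rw [sum_comm, ← zero]
    exact sum_congr rfl fun i _ => sum_congr rfl fun j _ => by rw [ha j i]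
  simp only [key, mul_add, sum_add_distrib, zero, zero', add_zero]

/-- One step of the Hegselmann–Krause dynamics decreases the energy by at least four times the
kinetic energy of that step. -/
theorem hk_energy_step {ι V : Type*} [Fintype ι] [NormedAddCommGroup V]
    [InnerProductSpace ℝ V] {d : ℝ} (hd : 0 ≤ d) (x y : ι → V)
    (hy : ∀ i, y i = (((univ.filter (fun j => ‖x j - x i‖ ≤ d)).card : ℝ))⁻¹ •
      ∑ j ∈ univ.filter (fun j => ‖x j - x i‖ ≤ d), x j) :
    4 * ∑ i, ‖y i - x i‖ ^ 2 + ∑ i, ∑ j, min (‖y i - y j‖ ^ 2) (d ^ 2) ≤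
      ∑ i, ∑ j, min (‖x i - x j‖ ^ 2) (d ^ 2) := by
  classical
  let a : ι → ι → ℝ := fun i j => if ‖x j - x i‖ ≤ d then 1 else 0
  have ha0 : ∀ i j, 0 ≤ a i j := fun i j => by
    simp only [a]
    split_ifs <;> norm_num
  have hdecrease := sum_mul_norm_sub_sq_sub_eq a
    (fun i j => by simp only [a, norm_sub_rev]) x (fun i => y i - x i) (fun i => by
      have hne : ((univ.filter (fun j => ‖x j - x i‖ ≤ d)).card : ℝ) ≠ 0 := by
        have : i ∈ univ.filter (fun j => ‖x j - x i‖ ≤ d) := by simpa using hd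
        exact_mod_cast (card_pos.mpr ⟨i, this⟩).ne'
      simp only [a, ite_smul, one_smul, zero_smul, ← sum_filter, sub_sub, add_sub_cancel]
      rw [sum_sub_distrib, sum_const, hy i, ← Nat.cast_smul_eq_nsmul ℝ, smul_smul,
        mul_inv_cancel₀ hne, one_smul, sub_self])
  simp only [add_sub_cancel] at hdecrease
  have hdiag : 4 * ∑ i, ‖y i - x i‖ ^ 2 ≤
      ∑ i, ∑ j, a i j * ‖(y i - x i) + (y j - x j)‖ ^ 2 := by
    rw [mul_sum]
    refine sum_le_sum fun i _ => ?_
    refine le_trans (le_of_eq ?_) (single_le_sum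
      (f := fun j => a i j * ‖(y i - x i) + (y j - x j)‖ ^ 2)
      (fun j _ => mul_nonneg (ha0 i j) (sq_nonneg _)) (mem_univ i))
    simp only [a, sub_self, norm_zero, hd, if_true, one_mul, ← two_smul ℝ (y i - x i), norm_smul,
      mul_pow]
    norm_num
  have hmin : ∑ i, ∑ j, a i j * (‖x i - x j‖ ^ 2 - ‖y i - y j‖ ^ 2) ≤
      ∑ i, ∑ j, (min (‖x i - x j‖ ^ 2) (d ^ 2) - min (‖y i - y j‖ ^ 2) (d ^ 2)) := by
    refine sum_le_sum fun i _ => sum_le_sum fun j _ => ?_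
    simp only [a, norm_sub_rev (x j) (x i)]
    split_ifs with h
    · rw [min_eq_left (pow_le_pow_left₀ (norm_nonneg _) h 2), one_mul]
      exact sub_le_sub_left (min_le_left _ _) _
    · rw [min_eq_right (pow_le_pow_left₀ hd (not_le.mp h).le 2), zero_mul]
      exact sub_nonneg.mpr (min_le_right _ _)
  simp only [sum_sub_distrib] at hmin
  linarith

/-- The energy of `n` opinions is at most `d² n (n - 1)`, as diagonal pairs contribute zero. -/
theorem sum_min_norm_sub_sq_le {V : Type*} [SeminormedAddCommGroup V] (n : ℕ) (d : ℝ)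
    (x : Fin n → V) :
    ∑ i, ∑ j, min (‖x i - x j‖ ^ 2) (d ^ 2) ≤ d ^ 2 * n * (n - 1) := by
  calc ∑ i, ∑ j, min (‖x i - x j‖ ^ 2) (d ^ 2)
      ≤ ∑ i : Fin n, ∑ j : Fin n, (d ^ 2 - if i = j then d ^ 2 else 0) := by
        refine sum_le_sum fun i _ => sum_le_sum fun j _ => ?_
        split_ifs with h
        · subst h
          simp [sq_nonneg]
        · simp
    _ = d ^ 2 * n * (n - 1) := by
        simp [sum_sub_distrib]
        ring

/-- **Kinetic 2-energy bound for the HK model.**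
For the multidimensional HK model with the Euclidean norm, the total kinetic
2-energy `∑_{k=0}^∞ ∑ᵢ ‖xᵢ(k+1) − xᵢ(k)‖²` (i.e. every partial sum thereof)
is bounded by the initial energy `E(x(0))`, which in turn is at most
`d² n (n−1)`, where `E(x) = ∑_{i,j} min(‖x i − x j‖², d²)`. -/
theorem hk_kinetic_energy_bound (n m : ℕ) (d : ℝ) (hd : 0 < d)
    (x : ℕ → Fin n → EuclideanSpace ℝ (Fin m))
    (hdyn : ∀ k i, x (k + 1) i =
      (((univ.filter (fun j => ‖x k j - x k i‖ ≤ d)).card : ℝ))⁻¹ •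
        ∑ j ∈ univ.filter (fun j => ‖x k j - x k i‖ ≤ d), x k j)
    (E : (Fin n → EuclideanSpace ℝ (Fin m)) → ℝ)
    (hE : ∀ y, E y = ∑ i, ∑ j, min (‖y i - y j‖ ^ 2) (d ^ 2)) :
    (∀ K : ℕ, ∑ k ∈ Finset.range K, ∑ i, ‖x (k + 1) i - x k i‖ ^ 2 ≤ E (x 0)) ∧
    E (x 0) ≤ d ^ 2 * n * (n - 1) := by
  have hstep : ∀ k, ∑ i, ‖x (k + 1) i - x k i‖ ^ 2 + E (x (k + 1)) ≤ E (x k) := by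
    intro k
    have h := hk_energy_step hd.le (x k) (x (k + 1)) (hdyn k)
    have h0 : 0 ≤ ∑ i, ‖x (k + 1) i - x k i‖ ^ 2 := sum_nonneg fun i _ => sq_nonneg _
    rw [hE, hE]
    linarith
  refine ⟨fun K => ?_, (hE _).trans_le (sum_min_norm_sub_sq_le n d (x 0))⟩
  have hsum : ∑ k ∈ Finset.range K, ∑ i, ‖x (k + 1) i - x k i‖ ^ 2 + E (x K) ≤ E (x 0) := by
    induction K with
    | zero => simp
    | succ K ih =>
      rw [sum_range_succ]
      linarith [hstep K]
  have hE0 : 0 ≤ E (x K) := by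
    rw [hE]
    exact sum_nonneg fun i _ => sum_nonneg fun j _ => le_min (sq_nonneg _) (sq_nonneg _)
  linarith
end

section
/- Suppose φ : [0,∞) → [0,∞) is non-increasing with φ(0) > 0, and let x(·) evolve by the distance-based averaging dynamics x_i(k+1) = (Σ_{j=1}^n φ_{ij}(k) x_j(k)) / (Σ_{j=1}^n φ_{ij}(k)) with φ_{ij}(k) = φ(|x_j(k) − x_i(k)|²). Then the energy E_φ(x) = Σ_{i,j=1}^n Φ(|x_i − x_j|²), where Φ(r) = ∫_0^r φ(σ) dσ, is non-increasing along trajectories and satisfies E_φ(x(k)) − E_φ(x(k+1)) ≥ Σ_{i,j=1}^n φ_{ij}(k) |Δx_i(k) + Δx_j(k)|² ≥ 4 φ(0) Σ_{i=1}^n |Δx_i(k)|², where Δx_i(k) = x_i(k+1) − x_i(k). -/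
open Finset

/-- The integral `r ↦ ∫₀ʳ φ` of a function that is non-increasing on `[0, ∞)` lies below its
tangent lines, with slope `φ a` at `a`. -/
lemma integral_le_add_mul_sub_of_antitoneOn {φ : ℝ → ℝ} (hφ : AntitoneOn φ (Set.Ici 0))
    {a b : ℝ} (ha : 0 ≤ a) (hb : 0 ≤ b) :
    ∫ σ in (0:ℝ)..b, φ σ ≤ (∫ σ in (0:ℝ)..a, φ σ) + φ a * (b - a) := by
  have hφ_int : ∀ {u v : ℝ}, 0 ≤ u → 0 ≤ v → IntervalIntegrable φ MeasureTheory.volume u v :=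
    fun hu hv => AntitoneOn.intervalIntegrable
      (hφ.mono fun _ hσ => (le_min hu hv).trans hσ.1)
  rcases le_total a b with hab | hba
  · have hsplit := intervalIntegral.integral_add_adjacent_intervals (hφ_int le_rfl ha) (hφ_int ha hb)
    have hle : ∫ σ in a..b, φ σ ≤ ∫ _ in a..b, φ a :=
      intervalIntegral.integral_mono_on hab (hφ_int ha hb) intervalIntegrable_const
        fun σ hσ => hφ ha (ha.trans hσ.1) hσ.1
    rw [intervalIntegral.integral_const, smul_eq_mul] at hle
    linarith
  · have hsplit := intervalIntegral.integral_add_adjacent_intervals (hφ_int le_rfl hb) (hφ_int hb ha)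
    have hle : ∫ _ in b..a, φ a ≤ ∫ σ in b..a, φ σ :=
      intervalIntegral.integral_mono_on hba intervalIntegrable_const (hφ_int hb ha)
        fun σ hσ => hφ (hb.trans hσ.1) ha hσ.2
    rw [intervalIntegral.integral_const, smul_eq_mul] at hle
    linarith

/-- For symmetric weights `w`, the weighted energy `∑ w i j * ‖x i - x j‖ ^ 2` dissipates
`∑ w i j * ‖d i + d j‖ ^ 2` when each point `x i` moves by `d i` to the weighted average of all
points. -/
lemma sum_mul_norm_sub_sq_sub_of_average {ι E : Type*} [Fintype ι] [NormedAddCommGroup E]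
    [InnerProductSpace ℝ E] {w : ι → ι → ℝ} (hw : ∀ i j, w i j = w j i) {x d : ι → E}
    (hd : ∀ i, ∑ j, w i j • (x i - x j + d i) = 0) :
    ∑ i, ∑ j, w i j * (‖x i - x j‖ ^ 2 - ‖x i + d i - (x j + d j)‖ ^ 2) =
      ∑ i, ∑ j, w i j * ‖d i + d j‖ ^ 2 := by
  have hg : ∑ i, ∑ j, w i j * inner ℝ (x i - x j + d i) (d i) = 0 := by
    refine Finset.sum_eq_zero fun i _ => ?_
    simp_rw [← real_inner_smul_left, ← sum_inner, hd, inner_zero_left]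
  have hg' : ∑ i, ∑ j, w i j * inner ℝ (x j - x i + d j) (d j) = 0 := by
    rw [Finset.sum_comm]
    simpa only [hw] using hg
  have hpoint : ∀ i j, w i j * (‖x i - x j‖ ^ 2 - ‖x i + d i - (x j + d j)‖ ^ 2) =
      w i j * ‖d i + d j‖ ^ 2 - 2 * (w i j * inner ℝ (x i - x j + d i) (d i)) -
        2 * (w i j * inner ℝ (x j - x i + d j) (d j)) := by
    intro i j
    simp only [← real_inner_self_eq_norm_sq, inner_add_left, inner_add_right, inner_sub_left,
      inner_sub_right]
    rw [real_inner_comm (x i) (x j), real_inner_comm (d i) (d j), real_inner_comm (x i) (d i),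
      real_inner_comm (x i) (d j), real_inner_comm (x j) (d i), real_inner_comm (x j) (d j)]
    ring
  simp_rw [hpoint, Finset.sum_sub_distrib, ← Finset.mul_sum, hg, hg']
  ring

/-- The diagonal terms alone bound `∑ w i j * ‖d i + d j‖ ^ 2` from below. -/
lemma four_mul_sum_diag_le {ι E : Type*} [Fintype ι] [NormedAddCommGroup E]
    [InnerProductSpace ℝ E] {w : ι → ι → ℝ} (hw : ∀ i j, 0 ≤ w i j) (d : ι → E) :
    4 * ∑ i, w i i * ‖d i‖ ^ 2 ≤ ∑ i, ∑ j, w i j * ‖d i + d j‖ ^ 2 := by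
  rw [Finset.mul_sum]
  refine Finset.sum_le_sum fun i _ => ?_
  have hdiag : 4 * (w i i * ‖d i‖ ^ 2) = w i i * ‖d i + d i‖ ^ 2 := by
    rw [← two_smul ℝ, norm_smul, Real.norm_ofNat]
    ring
  rw [hdiag]
  exact Finset.single_le_sum (f := fun j => w i j * ‖d i + d j‖ ^ 2)
    (fun j _ => mul_nonneg (hw i j) (sq_nonneg _)) (Finset.mem_univ i)

/-- **Energy decrease for distance-based averaging dynamics (Jabin–Motsch).**
Let `φ : [0,∞) → [0,∞)` be non-increasing with `φ(0) > 0`, and let the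
multidimensional opinions evolve by
`xᵢ(k+1) = (∑ⱼ φᵢⱼ(k) xⱼ(k)) / (∑ⱼ φᵢⱼ(k))` with
`φᵢⱼ(k) = φ(‖xⱼ(k) − xᵢ(k)‖²)`.  Then the energy
`E_φ(x) = ∑_{i,j} Φ(‖xᵢ − xⱼ‖²)`, `Φ(r) = ∫₀ʳ φ(σ) dσ`, is non-increasing
along trajectories and satisfies
`E_φ(x(k)) − E_φ(x(k+1)) ≥ ∑_{i,j} φᵢⱼ(k) ‖Δxᵢ(k) + Δxⱼ(k)‖²
  ≥ 4 φ(0) ∑ᵢ ‖Δxᵢ(k)‖²`, where `Δxᵢ(k) = xᵢ(k+1) − xᵢ(k)`. -/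
theorem jabin_motsch_energy_decrease (n m : ℕ)
    (φ : ℝ → ℝ)
    (hφ_nonneg : ∀ σ, 0 ≤ σ → 0 ≤ φ σ)
    (hφ_mono : ∀ σ τ, 0 ≤ σ → σ ≤ τ → φ τ ≤ φ σ)
    (hφ0 : 0 < φ 0)
    (x : ℕ → Fin n → EuclideanSpace ℝ (Fin m))
    (hdyn : ∀ k i, x (k + 1) i =
      (∑ j, φ (‖x k j - x k i‖ ^ 2))⁻¹ •
        ∑ j, φ (‖x k j - x k i‖ ^ 2) • x k j)
    (Φ : ℝ → ℝ) (hΦ : ∀ r, Φ r = ∫ σ in (0:ℝ)..r, φ σ)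
    (Eφ : (Fin n → EuclideanSpace ℝ (Fin m)) → ℝ)
    (hEφ : ∀ y, Eφ y = ∑ i, ∑ j, Φ (‖y i - y j‖ ^ 2)) :
    ∀ k,
      Eφ (x (k + 1)) ≤ Eφ (x k) ∧
      (∑ i, ∑ j, φ (‖x k j - x k i‖ ^ 2) *
          ‖(x (k + 1) i - x k i) + (x (k + 1) j - x k j)‖ ^ 2) ≤
        Eφ (x k) - Eφ (x (k + 1)) ∧
      4 * φ 0 * ∑ i, ‖x (k + 1) i - x k i‖ ^ 2 ≤
        ∑ i, ∑ j, φ (‖x k j - x k i‖ ^ 2) *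
          ‖(x (k + 1) i - x k i) + (x (k + 1) j - x k j)‖ ^ 2 := by
  intro k
  have hanti : AntitoneOn φ (Set.Ici 0) := fun σ hσ τ _ h => hφ_mono σ τ hσ h
  set w : Fin n → Fin n → ℝ := fun i j => φ (‖x k j - x k i‖ ^ 2) with hw_def
  set d : Fin n → EuclideanSpace ℝ (Fin m) := fun i => x (k + 1) i - x k i with hd_def
  have hw_nonneg : ∀ i j, 0 ≤ w i j := fun i j => hφ_nonneg _ (sq_nonneg _)
  have hw_symm : ∀ i j, w i j = w j i := fun i j => by simp only [hw_def, norm_sub_rev]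
  have hw_diag : ∀ i, w i i = φ 0 := fun i => by simp [hw_def]
  have hpos : ∀ i, 0 < ∑ j, w i j := fun i =>
    Finset.sum_pos' (fun j _ => hw_nonneg i j) ⟨i, Finset.mem_univ i, by rwa [hw_diag]⟩
  have hd : ∀ i, ∑ j, w i j • (x k i - x k j + d i) = 0 := by
    intro i
    have hdi : ∀ j, x k i - x k j + d i = x (k + 1) i - x k j := fun j => by
      simp only [hd_def]
      abel
    simp_rw [hdi, smul_sub, Finset.sum_sub_distrib, ← Finset.sum_smul]
    rw [hdyn k i, smul_inv_smul₀ (hpos i).ne', sub_self]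
  have hdiss := sum_mul_norm_sub_sq_sub_of_average hw_symm hd
  have hdecr : ∑ i, ∑ j, w i j * ‖d i + d j‖ ^ 2 ≤ Eφ (x k) - Eφ (x (k + 1)) := by
    rw [← hdiss, hEφ, hEφ, ← Finset.sum_sub_distrib]
    refine Finset.sum_le_sum fun i _ => ?_
    rw [← Finset.sum_sub_distrib]
    refine Finset.sum_le_sum fun j _ => ?_
    have htangent := integral_le_add_mul_sub_of_antitoneOn hanti
      (sq_nonneg ‖x k i - x k j‖) (sq_nonneg ‖x (k + 1) i - x (k + 1) j‖)
    simp only [hΦ, hw_def, hd_def, add_sub_cancel, norm_sub_rev (x k j) (x k i)]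
    linarith
  have hlower : 4 * φ 0 * ∑ i, ‖d i‖ ^ 2 ≤ ∑ i, ∑ j, w i j * ‖d i + d j‖ ^ 2 := by
    simpa only [hw_diag, ← Finset.mul_sum, mul_assoc] using four_mul_sum_diag_le hw_nonneg d
  have hnonneg : 0 ≤ 4 * φ 0 * ∑ i, ‖d i‖ ^ 2 := by positivity
  exact ⟨by linarith, hdecr, hlower⟩
end

section
/- Suppose φ : [0,∞) → [0,∞) satisfies φ(σ) ∈ {0} ∪ [a,b] for all σ ≥ 0, where 0 < a < b, and φ(0) > 0. Then for any initial opinions x_1(0),…,x_n(0) ∈ ℝ^m, the opinions obeying the dynamics x_i(k+1) = (Σ_{j=1}^n φ_{ij}(k) x_j(k)) / (Σ_{j=1}^n φ_{ij}(k)), with φ_{ij}(k) = φ(|x_j(k) − x_i(k)|²), converge: the limit lim_{k→∞} x_i(k) exists for every i. -/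
open Finset

/-- An Abel summation inequality: a weight `q` whose sums over all lower sets of the form
`{i < l}` are nonpositive pairs with a monotone `z` to at least `c * ∑ q`, for every upper
bound `c` of `z`. -/
lemma sum_mul_ge_of_prefix_sum_nonpos (n : ℕ) (q z : Fin n → ℝ) (hz : Monotone z)
    (hq : ∀ l : ℕ, l ≤ n → ∑ i : Fin n with i.val < l, q i ≤ 0)
    (c : ℝ) (hc : ∀ i, z i ≤ c) : (∑ i, q i) * c ≤ ∑ i, q i * z i := by
  induction n generalizing c with
  | zero => simp
  | succ n ih =>
    have hprefix : ∀ l : ℕ, l ≤ n → ∑ i : Fin n with i.val < l, q i.castSucc ≤ 0 := by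
      intro l hl
      have h := hq l (by omega)
      rw [Finset.sum_filter, Fin.sum_univ_castSucc] at h
      rw [Finset.sum_filter]
      simpa [hl.not_gt] using h
    have h1 := ih (fun i => q i.castSucc) (fun i => z i.castSucc)
      (fun i j hij => hz (Fin.castSucc_le_castSucc_iff.2 hij)) hprefix (z (Fin.last n))
      (fun i => hz (Fin.le_last _))
    have h2 : ∑ i, q i ≤ 0 := by
      have h := hq (n + 1) le_rfl
      rwa [Finset.filter_true_of_mem (fun i _ => i.isLt)] at h
    have h3 := mul_le_mul_of_nonpos_left (hc (Fin.last n)) h2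
    rw [Fin.sum_univ_castSucc] at h3 ⊢
    rw [Fin.sum_univ_castSucc]
    nlinarith

/-- Among the sets of at most `l` exponents, `{0, …, l - 1}` maximizes the sum of powers of
`c ∈ [0, 1]`. -/
lemma sum_pow_le_sum_range (c : ℝ) (hc0 : 0 ≤ c) (hc1 : c ≤ 1) (T : Finset ℕ) (l : ℕ)
    (hT : T.card ≤ l) : ∑ i ∈ T, c ^ i ≤ ∑ i ∈ range l, c ^ i := by
  have hcard : (T \ range l).card ≤ (range l \ T).card :=
    Finset.card_sdiff_le_card_sdiff_iff.2 (by simpa using hT)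
  have h1 : ∑ i ∈ T \ range l, c ^ i ≤ (T \ range l).card • c ^ l :=
    Finset.sum_le_card_nsmul _ _ _ fun i hi =>
      pow_le_pow_of_le_one hc0 hc1 (by simpa using (Finset.mem_sdiff.1 hi).2)
  have h2 : (range l \ T).card • c ^ l ≤ ∑ i ∈ range l \ T, c ^ i :=
    Finset.card_nsmul_le_sum _ _ _ fun i hi =>
      pow_le_pow_of_le_one hc0 hc1 (Finset.mem_range.1 (Finset.mem_sdiff.1 hi).1).le
  have h3 : (T \ range l).card • c ^ l ≤ (range l \ T).card • c ^ l :=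
    nsmul_le_nsmul_left (by positivity) hcard
  rw [← Finset.sum_inter_add_sum_sdiff T (range l), ← Finset.sum_inter_add_sum_sdiff (range l) T,
    Finset.inter_comm]
  linarith

lemma sum_perm_pow_le_sum_range {n : ℕ} (c : ℝ) (hc0 : 0 ≤ c) (hc1 : c ≤ 1)
    (σ : Equiv.Perm (Fin n)) (S : Finset (Fin n)) (l : ℕ) (hS : S.card ≤ l) :
    ∑ i ∈ S, c ^ (σ i).val ≤ ∑ i ∈ range l, c ^ i := by
  have hinj : Function.Injective fun i : Fin n => (σ i).val :=
    Fin.val_injective.comp σ.injective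
  have h := sum_pow_le_sum_range c hc0 hc1 (S.image fun i => (σ i).val) l
    (Finset.card_image_le.trans hS)
  rwa [Finset.sum_image hinj.injOn] at h

/-- Row-stochastic matrices with nonzero entries at least `δ`, positive diagonal, and a symmetric
zero pattern. -/
structure IsTypeSymmetricStochastic {n : ℕ} (δ : ℝ) (w : Fin n → Fin n → ℝ) : Prop where
  row_sum : ∀ i, ∑ j, w i j = 1
  eq_zero_or_ge : ∀ i j, w i j = 0 ∨ δ ≤ w i j
  diag_ge : ∀ i, δ ≤ w i i
  zero_symm : ∀ i j, w i j = 0 → w j i = 0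

namespace IsTypeSymmetricStochastic

variable {n : ℕ} {δ : ℝ} {w : Fin n → Fin n → ℝ}

lemma nonneg (hw : IsTypeSymmetricStochastic δ w) (hδ : 0 < δ) (i j : Fin n) : 0 ≤ w i j := by
  rcases hw.eq_zero_or_ge i j with h | h <;> linarith

lemma sum_le_one (hw : IsTypeSymmetricStochastic δ w) (hδ : 0 < δ) (S : Finset (Fin n))
    (i : Fin n) : ∑ j ∈ S, w i j ≤ 1 :=
  (Finset.sum_le_univ_sum_of_nonneg (hw.nonneg hδ i)).trans_eq (hw.row_sum i)

lemma sum_le_one_sub (hw : IsTypeSymmetricStochastic δ w) (hδ : 0 < δ) (S : Finset (Fin n))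
    (i j : Fin n) (hj : j ∉ S) (hij : δ ≤ w i j) : ∑ k ∈ S, w i k ≤ 1 - δ := by
  have h := hw.sum_le_one hδ (insert j S) i
  rw [Finset.sum_insert hj] at h
  linarith

lemma reindex (hw : IsTypeSymmetricStochastic δ w) (τ : Equiv.Perm (Fin n)) :
    IsTypeSymmetricStochastic δ fun i j => w (τ i) (τ j) where
  row_sum i := (Equiv.sum_comp τ (w (τ i))).trans (hw.row_sum _)
  eq_zero_or_ge _ _ := hw.eq_zero_or_ge _ _
  diag_ge _ := hw.diag_ge _
  zero_symm _ _ := hw.zero_symm _ _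

lemma weighted_sum_le_of_no_crossing (hw : IsTypeSymmetricStochastic δ w) (hδ : 0 < δ)
    {c : ℝ} (hc0 : 0 ≤ c) (hc1 : c ≤ 1) (σ : Equiv.Perm (Fin n)) (S : Finset (Fin n))
    (hS : ∀ i ∈ S, ∀ j ∉ S, w i j = 0) :
    ∑ i, c ^ (σ i).val * ∑ j ∈ S, w i j ≤ ∑ i ∈ range S.card, c ^ i := by
  refine le_trans ?_ (sum_perm_pow_le_sum_range c hc0 hc1 σ S _ le_rfl)
  rw [← Finset.sum_subset (Finset.subset_univ S)]
  · exact Finset.sum_le_sum fun i _ =>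
      mul_le_of_le_one_right (by positivity) (hw.sum_le_one hδ S i)
  · intro i _ hi
    rw [Finset.sum_eq_zero fun j hj => hw.zero_symm _ _ (hS j hj i hi), mul_zero]

lemma weighted_sum_le_of_crossing (hw : IsTypeSymmetricStochastic δ w) (hδ : 0 < δ)
    (hδ1 : δ ≤ 1) (σ : Equiv.Perm (Fin n)) (S : Finset (Fin n)) {i₀ j₀ : Fin n}
    (hi₀ : i₀ ∈ S) (hj₀ : j₀ ∉ S) (hne : w i₀ j₀ ≠ 0) :
    ∑ i, (δ / 4) ^ (σ i).val * ∑ j ∈ S, w i j ≤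
      ∑ i ∈ range S.card, (δ / 4) ^ i - δ / 2 * (δ / 4) ^ n := by
  set c := δ / 4 with hc
  have hc0 : 0 < c := by positivity
  have hc1 : c < 1 := by linarith
  obtain ⟨l, hl⟩ : ∃ l, S.card = l + 1 :=
    ⟨S.card - 1, by have := Finset.card_pos.2 ⟨i₀, hi₀⟩; omega⟩
  have hln : l ≤ n := by
    have := Finset.card_le_univ S
    rw [Fintype.card_fin] at this
    omega
  have hrow : ∀ i, i ∉ S.erase i₀ → ∑ j ∈ S, w i j ≤ 1 - δ := by
    intro i hi
    by_cases h : i = i₀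
    · subst h
      exact hw.sum_le_one_sub hδ S _ _ hj₀ ((hw.eq_zero_or_ge _ _).resolve_left hne)
    · exact hw.sum_le_one_sub hδ S i i (fun hS => hi (Finset.mem_erase.2 ⟨h, hS⟩)) (hw.diag_ge i)
  have h1 : ∑ i, c ^ (σ i).val * ∑ j ∈ S, w i j ≤
      δ * ∑ i ∈ S.erase i₀, c ^ (σ i).val + (1 - δ) * ∑ i, c ^ (σ i).val := by
    rw [← Finset.sum_ite_mem_eq (S.erase i₀), Finset.mul_sum, Finset.mul_sum,
      ← Finset.sum_add_distrib]
    refine Finset.sum_le_sum fun i _ => ?_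
    have hpow : 0 < c ^ (σ i).val := by positivity
    split_ifs with hi
    · have := mul_le_mul_of_nonneg_left (hw.sum_le_one hδ S i) hpow.le
      linarith
    · have := mul_le_mul_of_nonneg_left (hrow i hi) hpow.le
      linarith
  have h2 : ∑ i ∈ S.erase i₀, c ^ (σ i).val ≤ ∑ i ∈ range l, c ^ i :=
    sum_perm_pow_le_sum_range c hc0.le hc1.le σ _ l (by rw [Finset.card_erase_of_mem hi₀]; omega)
  have h3 : ∑ i, c ^ (σ i).val = ∑ i ∈ range n, c ^ i := by
    rw [Equiv.sum_comp σ fun i => c ^ i.val, Fin.sum_univ_eq_sum_range]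
  have h4 : ∑ i ∈ range n, c ^ i * (1 - c) ≤ ∑ i ∈ range l, c ^ i * (1 - c) + c ^ l := by
    rw [← Finset.sum_mul, ← Finset.sum_mul, geom_sum_mul_neg, geom_sum_mul_neg]
    have : 0 < c ^ n := by positivity
    linarith
  rw [← Finset.sum_mul, ← Finset.sum_mul] at h4
  rw [h3] at h1
  rw [hl, Finset.sum_range_succ]
  have hpow : c ^ n ≤ c ^ l := pow_le_pow_of_le_one hc0.le hc1.le hln
  have hl0 : 0 < c ^ l := by positivity
  have h5 : ∑ i ∈ range n, c ^ i - ∑ i ∈ range l, c ^ i ≤ c ^ l / (1 - c) := by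
    rw [le_div_iff₀ (by linarith)]
    linarith
  have h6 : (1 - δ) * (c ^ l / (1 - c)) ≤ (1 - δ / 2) * c ^ l := by
    rw [← mul_div_assoc, div_le_iff₀ (by linarith), mul_right_comm]
    exact mul_le_mul_of_nonneg_right (by rw [hc]; nlinarith [sq_nonneg δ]) hl0.le
  have h7 := mul_le_mul_of_nonneg_left h5 (sub_nonneg.2 hδ1)
  have h8 := mul_le_mul_of_nonneg_left h2 hδ.le
  have h9 := mul_le_mul_of_nonneg_left hpow hδ.le
  linarith

/-- For sorted opinions `z`, every permuted weighted sum after one averaging step exceeds the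
sorted weighted sum by at least a multiple of the gap between any two interacting agents. -/
lemma sum_add_sub_le_of_monotone (hw : IsTypeSymmetricStochastic δ w) (hδ : 0 < δ)
    (hδ1 : δ ≤ 1) (σ : Equiv.Perm (Fin n)) {z : Fin n → ℝ} (hz : Monotone z) {i₀ j₀ : Fin n}
    (hne : w i₀ j₀ ≠ 0) :
    ∑ i, (δ / 4) ^ i.val * z i + δ / 2 * (δ / 4) ^ n * (z j₀ - z i₀) ≤
      ∑ i, (δ / 4) ^ (σ i).val * ∑ j, w i j * z j := by
  set c := δ / 4 with hc
  have hc0 : 0 < c := by positivity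
  have hc1 : c < 1 := by linarith
  set η := δ / 2 * c ^ n with hη
  have hη0 : 0 < η := by positivity
  set q : Fin n → ℝ := fun j => ∑ i, c ^ (σ i).val * w i j - c ^ j.val
    - (if j = j₀ then η else 0) + (if j = i₀ then η else 0) with hq
  have hsum : ∀ S : Finset (Fin n), ∑ j ∈ S, q j =
      ∑ i, c ^ (σ i).val * ∑ j ∈ S, w i j - ∑ j ∈ S, c ^ j.val
        - (if j₀ ∈ S then η else 0) + (if i₀ ∈ S then η else 0) := by
    intro S
    simp only [hq, Finset.sum_add_distrib, Finset.sum_sub_distrib, Finset.sum_ite_eq',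
      Finset.mul_sum]
    rw [Finset.sum_comm]
  have htotal : ∑ j, q j = 0 := by
    rw [hsum]
    simp only [hw.row_sum, mul_one, Finset.mem_univ, if_true]
    rw [Equiv.sum_comp σ fun i => c ^ i.val]
    ring
  have hprefix : ∀ l : ℕ, l ≤ n → ∑ i : Fin n with i.val < l, q i ≤ 0 := by
    intro l hl
    have hcard : (Finset.univ.filter fun i : Fin n => i.val < l).card = l := by
      rw [Fin.card_filter_val_lt, min_eq_right hl]
    have hpow : ∑ j : Fin n with j.val < l, c ^ j.val = ∑ i ∈ range l, c ^ i := by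
      refine Finset.sum_nbij (fun j : Fin n => j.val) (by simp) Fin.val_injective.injOn ?_
        (fun _ _ => rfl)
      intro k hk
      have hk' : k < l := by simpa using hk
      exact ⟨⟨k, hk'.trans_le hl⟩, by simpa using hk', rfl⟩
    rw [hsum, hpow]
    by_cases hcross : ∃ i ∈ Finset.univ.filter (fun i : Fin n => i.val < l),
        ∃ j ∉ Finset.univ.filter (fun i : Fin n => i.val < l), w i j ≠ 0
    · obtain ⟨i, hi, j, hj, hij⟩ := hcross
      have h := hw.weighted_sum_le_of_crossing hδ hδ1 σ _ hi hj hij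
      rw [hcard] at h
      split_ifs <;> linarith
    · push Not at hcross
      have h := hw.weighted_sum_le_of_no_crossing hδ hc0.le hc1.le σ _ hcross
      rw [hcard] at h
      have h' : i₀.val < l → j₀.val < l := by
        intro hi
        by_contra hj
        exact hne (hcross i₀ (by simpa using hi) j₀ (by simpa using hj))
      simp only [Finset.mem_filter, Finset.mem_univ, true_and]
      split_ifs with h1 h2 <;> first | linarith | exact absurd (h' ‹_›) ‹_›
  have hmain : 0 ≤ ∑ j, q j * z j := by
    have h := sum_mul_ge_of_prefix_sum_nonpos n q z hz hprefix
      (z ⟨n - 1, by have := i₀.isLt; omega⟩)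
      (fun i => hz (Fin.le_def.2 (by have := i.isLt; simp only; omega)))
    simpa [htotal] using h
  have hexpand : ∑ j, q j * z j = ∑ i, c ^ (σ i).val * ∑ j, w i j * z j
      - ∑ j, c ^ j.val * z j - η * z j₀ + η * z i₀ := by
    simp only [hq, add_mul, sub_mul, Finset.sum_add_distrib, Finset.sum_sub_distrib, ite_mul,
      zero_mul, Finset.sum_ite_eq', Finset.mem_univ, if_true, Finset.mul_sum, Finset.sum_mul]
    rw [Finset.sum_comm]
    simp only [mul_assoc]
  rw [hexpand] at hmain
  linarith

end IsTypeSymmetricStochastic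

/-- The least value of `∑ i, c ^ σ i * y i` over all permutations `σ`. -/
noncomputable def minPermSum {n : ℕ} (c : ℝ) (y : Fin n → ℝ) : ℝ :=
  Finset.univ.inf' Finset.univ_nonempty fun σ : Equiv.Perm (Fin n) => ∑ i, c ^ (σ i).val * y i

lemma minPermSum_le {n : ℕ} (c : ℝ) (y : Fin n → ℝ) (σ : Equiv.Perm (Fin n)) :
    minPermSum c y ≤ ∑ i, c ^ (σ i).val * y i :=
  Finset.inf'_le _ (Finset.mem_univ σ)

namespace IsTypeSymmetricStochastic

variable {n : ℕ} {δ : ℝ} {w : Fin n → Fin n → ℝ}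

lemma minPermSum_add_abs_le (hw : IsTypeSymmetricStochastic δ w) (hδ : 0 < δ) (hδ1 : δ ≤ 1)
    (y : Fin n → ℝ) {i₀ j₀ : Fin n} (hne : w i₀ j₀ ≠ 0) :
    minPermSum (δ / 4) y + δ / 2 * (δ / 4) ^ n * |y j₀ - y i₀| ≤
      minPermSum (δ / 4) fun i => ∑ j, w i j * y j := by
  refine Finset.le_inf' _ _ fun σ _ => ?_
  set τ := Tuple.sort y
  have hz : Monotone (y ∘ τ) := Tuple.monotone_sort y
  have hV : minPermSum (δ / 4) y ≤ ∑ i, (δ / 4) ^ i.val * y (τ i) := by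
    refine (minPermSum_le _ y τ.symm).trans_eq ?_
    rw [← Equiv.sum_comp τ]
    simp
  have hright : ∑ i, (δ / 4) ^ (σ i).val * ∑ j, w i j * y j =
      ∑ i, (δ / 4) ^ ((τ.trans σ) i).val * ∑ j, w (τ i) (τ j) * y (τ j) := by
    rw [← Equiv.sum_comp τ]
    refine Finset.sum_congr rfl fun i _ => ?_
    rw [← Equiv.sum_comp τ fun j => w (τ i) j * y j]
    rfl
  rw [hright]
  have key : ∀ i j : Fin n, i ≤ j → w (τ i) (τ j) ≠ 0 →
      minPermSum (δ / 4) y + δ / 2 * (δ / 4) ^ n * |y (τ j) - y (τ i)| ≤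
        ∑ i, (δ / 4) ^ ((τ.trans σ) i).val * ∑ j, w (τ i) (τ j) * y (τ j) := by
    intro i j hij hwij
    have h := (hw.reindex τ).sum_add_sub_le_of_monotone hδ hδ1 (τ.trans σ) hz hwij
    have hle : y (τ i) ≤ y (τ j) := hz hij
    rw [abs_of_nonneg (sub_nonneg.2 hle)]
    simp only [Function.comp_apply] at h
    linarith
  obtain ⟨i, rfl⟩ := τ.surjective i₀
  obtain ⟨j, rfl⟩ := τ.surjective j₀
  rcases le_total i j with h | h
  · exact key i j h hne
  · rw [abs_sub_comm]
    exact key j i h fun h0 => hne (hw.zero_symm _ _ h0)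

lemma abs_average_sub_le (hw : IsTypeSymmetricStochastic δ w) (hδ : 0 < δ) (y : Fin n → ℝ)
    (i : Fin n) (r : ℝ) (hr : ∀ j, w i j ≠ 0 → |y j - y i| ≤ r) :
    |∑ j, w i j * y j - y i| ≤ r := by
  have h : ∑ j, w i j * y j - y i = ∑ j, w i j * (y j - y i) := by
    simp [mul_sub, Finset.sum_sub_distrib, ← Finset.sum_mul, hw.row_sum]
  rw [h]
  calc |∑ j, w i j * (y j - y i)| ≤ ∑ j, |w i j * (y j - y i)| := Finset.abs_sum_le_sum_abs _ _
    _ ≤ ∑ j, w i j * r := Finset.sum_le_sum fun j _ => by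
        rw [abs_mul, abs_of_nonneg (hw.nonneg hδ i j)]
        by_cases h0 : w i j = 0
        · simp [h0]
        · exact mul_le_mul_of_nonneg_left (hr j h0) (hw.nonneg hδ i j)
    _ = r := by rw [← Finset.sum_mul, hw.row_sum, one_mul]

lemma abs_average_le (hw : IsTypeSymmetricStochastic δ w) (hδ : 0 < δ) (y : Fin n → ℝ) (M : ℝ)
    (hM : ∀ i, |y i| ≤ M) (i : Fin n) : |∑ j, w i j * y j| ≤ M :=
  calc |∑ j, w i j * y j| ≤ ∑ j, |w i j * y j| := Finset.abs_sum_le_sum_abs _ _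
    _ ≤ ∑ j, w i j * M := Finset.sum_le_sum fun j _ => by
        rw [abs_mul, abs_of_nonneg (hw.nonneg hδ i j)]
        exact mul_le_mul_of_nonneg_left (hM j) (hw.nonneg hδ i j)
    _ = M := by rw [← Finset.sum_mul, hw.row_sum, one_mul]

/-- Scalar averaging dynamics driven by type-symmetric stochastic matrices converge. -/
theorem exists_tendsto {w : ℕ → Fin n → Fin n → ℝ}
    (hw : ∀ k, IsTypeSymmetricStochastic δ (w k)) (hδ : 0 < δ) (hδ1 : δ ≤ 1)
    (y : ℕ → Fin n → ℝ) (hy : ∀ k i, y (k + 1) i = ∑ j, w k i j * y k j) (i : Fin n) :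
    ∃ L, Filter.Tendsto (fun k => y k i) Filter.atTop (nhds L) := by
  set η := δ / 2 * (δ / 4) ^ n with hη
  have hη0 : 0 < η := by positivity
  set V : ℕ → ℝ := fun k => minPermSum (δ / 4) (y k) with hV
  have hstep : ∀ k, |y (k + 1) i - y k i| ≤ (V (k + 1) - V k) / η := by
    intro k
    rw [hy]
    refine (hw k).abs_average_sub_le hδ _ i _ fun j hj => ?_
    rw [le_div_iff₀ hη0]
    have h := (hw k).minPermSum_add_abs_le hδ hδ1 (y k) hj
    rw [← funext (hy k)] at h
    simp only [hV, hη]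
    linarith
  obtain ⟨M, hM⟩ : ∃ M, ∀ k j, |y k j| ≤ M := by
    refine ⟨∑ j, |y 0 j|, fun k => ?_⟩
    induction k with
    | zero =>
      exact fun j => Finset.single_le_sum (f := fun j => |y 0 j|) (fun _ _ => abs_nonneg _)
        (Finset.mem_univ j)
    | succ k ih =>
      intro j
      rw [hy]
      exact (hw k).abs_average_le hδ _ _ ih j
  have hVle : ∀ k, V k ≤ ∑ j : Fin n, (δ / 4) ^ j.val * M := fun k =>
    (minPermSum_le _ _ 1).trans <| Finset.sum_le_sum fun j _ =>
      mul_le_mul_of_nonneg_left ((le_abs_self _).trans (hM k j)) (by positivity)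
  have hsummable : Summable fun k => |y (k + 1) i - y k i| := by
    refine summable_of_sum_range_le (c := (∑ j : Fin n, (δ / 4) ^ j.val * M - V 0) / η)
      (fun _ => abs_nonneg _) fun N => ?_
    refine (Finset.sum_le_sum fun k _ => hstep k).trans ?_
    rw [← Finset.sum_div, Finset.sum_range_sub]
    have := hVle N
    gcongr
  refine cauchySeq_tendsto_of_complete (cauchySeq_of_summable_dist (hsummable.congr fun k => ?_))
  rw [dist_comm, Real.dist_eq]

/-- Normalizing the rows of a symmetric matrix with entries in `{0} ∪ [a, b]` and nonzero
diagonal. -/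
lemma of_symmetric {a b : ℝ} (ha : 0 < a) (hb : 0 < b) (f : Fin n → Fin n → ℝ)
    (hrange : ∀ i j, f i j = 0 ∨ (a ≤ f i j ∧ f i j ≤ b)) (hdiag : ∀ i, 0 < f i i)
    (hsymm : ∀ i j, f i j = f j i) :
    IsTypeSymmetricStochastic (a / (n * b)) fun i j => (∑ k, f i k)⁻¹ * f i j := by
  have hnonneg : ∀ i j, 0 ≤ f i j := fun i j => by
    rcases hrange i j with h | h <;> linarith
  have hle : ∀ i j, f i j ≤ b := fun i j => by
    rcases hrange i j with h | h <;> linarith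
  have hpos : ∀ i, 0 < ∑ k, f i k := fun i =>
    Finset.sum_pos' (fun j _ => hnonneg i j) ⟨i, Finset.mem_univ i, hdiag i⟩
  have hupper : ∀ i, ∑ k, f i k ≤ n * b := fun i => by
    simpa using Finset.sum_le_card_nsmul Finset.univ (f i) b fun j _ => hle i j
  have hge : ∀ i j, a ≤ f i j → a / (n * b) ≤ (∑ k, f i k)⁻¹ * f i j := by
    intro i j h
    rw [inv_mul_eq_div]
    exact div_le_div₀ (hnonneg i j) h (hpos i) (hupper i)
  refine ⟨fun i => ?_, fun i j => ?_, fun i => ?_, fun i j h => ?_⟩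
  · rw [← Finset.mul_sum, inv_mul_cancel₀ (hpos i).ne']
  · exact (hrange i j).imp (fun h => by simp [h]) fun h => hge i j h.1
  · exact hge i i ((hrange i i).resolve_left (hdiag i).ne').1
  · have h0 : f i j = 0 := (mul_eq_zero.1 h).resolve_left (inv_ne_zero (hpos i).ne')
    simp [← hsymm i j, h0]

end IsTypeSymmetricStochastic

/-- **Convergence of distance-based averaging dynamics.**
Suppose `φ : [0,∞) → [0,∞)` satisfies `φ(σ) ∈ {0} ∪ [a,b]` for all `σ ≥ 0`,
where `0 < a < b`, and `φ(0) > 0`.  Then for any initial opinions the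
dynamics `xᵢ(k+1) = (∑ⱼ φᵢⱼ(k) xⱼ(k)) / (∑ⱼ φᵢⱼ(k))`, with
`φᵢⱼ(k) = φ(‖xⱼ(k) − xᵢ(k)‖²)`, converges: each `xᵢ(k)` has a limit as
`k → ∞`. -/
theorem distance_based_dynamics_converge (n m : ℕ) (a b : ℝ)
    (ha : 0 < a) (hab : a < b)
    (φ : ℝ → ℝ)
    (hφ_range : ∀ σ, 0 ≤ σ → φ σ = 0 ∨ (a ≤ φ σ ∧ φ σ ≤ b))
    (hφ0 : 0 < φ 0)
    (x : ℕ → Fin n → EuclideanSpace ℝ (Fin m))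
    (hdyn : ∀ k i, x (k + 1) i =
      (∑ j, φ (‖x k j - x k i‖ ^ 2))⁻¹ •
        ∑ j, φ (‖x k j - x k i‖ ^ 2) • x k j) :
    ∀ i, ∃ L : EuclideanSpace ℝ (Fin m),
      Filter.Tendsto (fun k => x k i) Filter.atTop (nhds L) := by
  intro i
  have hb : 0 < b := ha.trans hab
  have hn : (1 : ℝ) ≤ n := by
    exact_mod_cast (Nat.succ_le_of_lt (Nat.zero_lt_of_lt i.isLt))
  have hδ : 0 < a / (n * b) := by positivity
  have hδ1 : a / (n * b) ≤ 1 := by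
    rw [div_le_one (by positivity)]
    nlinarith
  have hw : ∀ k, IsTypeSymmetricStochastic (a / (n * b)) fun i j : Fin n =>
      (∑ l, φ (‖x k l - x k i‖ ^ 2))⁻¹ * φ (‖x k j - x k i‖ ^ 2) := fun k =>
    IsTypeSymmetricStochastic.of_symmetric ha hb (fun i j => φ (‖x k j - x k i‖ ^ 2))
      (fun i j => hφ_range _ (by positivity)) (fun i => by simpa using hφ0)
      (fun i j => by simp only [norm_sub_rev])
  have hcoord : ∀ p : Fin m, ∃ L : ℝ,
      Filter.Tendsto (fun k => x k i p) Filter.atTop (nhds L) := fun p =>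
    IsTypeSymmetricStochastic.exists_tendsto hw hδ hδ1 (fun k j => x k j p)
      (fun k j => by simp [hdyn k j, Finset.mul_sum, mul_assoc]) i
  choose L hL using hcoord
  refine ⟨WithLp.toLp 2 L, ?_⟩
  exact ((PiLp.continuous_toLp 2 _).tendsto L).comp (tendsto_pi_nhds.2 hL)
end
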